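/- arXiv:1109.6765 — 5 statements merged into one kernel-verified Lean document; each statement's English description precedes it below -/
import Mathlib

section
/- Let H be a real inner product space and let J : H → [0,+∞] be positively one-homogeneous, i.e. J(0) = 0 and J(s·w) = s·J(w) for every s > 0 and every w ∈ H. Let f ∈ H and ε > 0. Then ω = 0 is a minimizer over H of the functional ω ↦ J(ω) + ‖ω − f‖²/(2ε) if and only if ε ≥ ‖f‖_* := sup{ ⟨f,w⟩ : w ∈ H, J(w) ≤ 1 } ∈ [0,+∞]; equivalently, if and only if ⟨f,w⟩ ≤ ε·J(w) (as elements of [−∞,+∞]) for every w ∈ H. -/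
open scoped ENNReal RealInnerProductSpace

section PositivelyHomogeneous

variable {H : Type*} [NormedAddCommGroup H] [InnerProductSpace ℝ H]
  {J : H → ℝ≥0∞} {f : H} {ε : ℝ}

/-- The pairing bound only has content where `J` is finite. -/
theorem pairing_le_iff_toReal (hε : 0 < ε) :
    (∀ w : H, ENNReal.ofReal ⟪f, w⟫ ≤ ENNReal.ofReal ε * J w) ↔
      ∀ w : H, J w ≠ ⊤ → ⟪f, w⟫ ≤ ε * (J w).toReal := by
  refine forall_congr' fun w => ?_
  by_cases hw : J w = ⊤
  · simp [hw, ENNReal.mul_top, hε]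
  · have hj : 0 ≤ ε * (J w).toReal := by positivity
    rw [← ENNReal.ofReal_le_ofReal_iff hj, ENNReal.ofReal_mul hε.le, ENNReal.ofReal_toReal hw]
    simp [hw]

/-- Minimality of `0` only has content where `J` is finite. -/
theorem zero_minimizes_iff_toReal (hJ0 : J 0 = 0) (hε : 0 < ε) :
    (∀ ω : H, J 0 + ENNReal.ofReal (‖(0 : H) - f‖ ^ 2 / (2 * ε)) ≤
        J ω + ENNReal.ofReal (‖ω - f‖ ^ 2 / (2 * ε))) ↔
      ∀ ω : H, J ω ≠ ⊤ → 2 * ⟪f, ω⟫ ≤ 2 * ε * (J ω).toReal + ‖ω‖ ^ 2 := by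
  refine forall_congr' fun ω => ?_
  by_cases hω : J ω = ⊤
  · simp [hω]
  · rw [hJ0, zero_add, zero_sub, norm_neg, ← ENNReal.ofReal_toReal hω,
      ← ENNReal.ofReal_add ENNReal.toReal_nonneg (by positivity),
      ENNReal.ofReal_le_ofReal_iff (by positivity),
      ENNReal.toReal_ofReal ENNReal.toReal_nonneg, div_le_iff₀ (by positivity), add_mul,
      div_mul_cancel₀ _ (by positivity), norm_sub_sq_real, real_inner_comm]
    simp only [ne_eq, ENNReal.ofReal_ne_top, not_false_eq_true, forall_const]
    constructor <;> intro h <;> linarith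

theorem zero_minimizes_iff_pairing_le (hJ0 : J 0 = 0)
    (hJhom : ∀ s : ℝ, 0 < s → ∀ w : H, J (s • w) = ENNReal.ofReal s * J w) (hε : 0 < ε) :
    (∀ ω : H, J 0 + ENNReal.ofReal (‖(0 : H) - f‖ ^ 2 / (2 * ε)) ≤
        J ω + ENNReal.ofReal (‖ω - f‖ ^ 2 / (2 * ε))) ↔
      ∀ w : H, ENNReal.ofReal ⟪f, w⟫ ≤ ENNReal.ofReal ε * J w := by
  rw [zero_minimizes_iff_toReal hJ0 hε, pairing_le_iff_toReal hε]
  refine ⟨fun h w hw => ?_, fun h ω hω => by nlinarith [h ω hω, sq_nonneg ‖ω‖]⟩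
  by_contra! hlt
  set g := ⟪f, w⟫ - ε * (J w).toReal with hg
  have hg0 : 0 < g := sub_pos.2 hlt
  set t := g / (‖w‖ ^ 2 + 1) with ht
  have ht0 : 0 < t := by positivity
  have htg : t * (‖w‖ ^ 2 + 1) = g := div_mul_cancel₀ _ (by positivity)
  have key := h (t • w) (by rw [hJhom t ht0]; exact ENNReal.mul_ne_top ENNReal.ofReal_ne_top hw)
  rw [hJhom t ht0, ENNReal.toReal_mul, ENNReal.toReal_ofReal ht0.le, real_inner_smul_right,
    norm_smul, Real.norm_of_nonneg ht0.le] at key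
  have hle : t * (2 * g) ≤ t * (t * ‖w‖ ^ 2) := by rw [hg]; linarith
  have := le_of_mul_le_mul_left hle ht0
  linarith

theorem iSup_pairing_le_iff
    (hJhom : ∀ s : ℝ, 0 < s → ∀ w : H, J (s • w) = ENNReal.ofReal s * J w) (hε : 0 < ε) :
    (⨆ w : {w : H // J w ≤ 1}, ENNReal.ofReal ⟪f, (w : H)⟫) ≤ ENNReal.ofReal ε ↔
      ∀ w : H, ENNReal.ofReal ⟪f, w⟫ ≤ ENNReal.ofReal ε * J w := by
  refine ⟨fun h => ?_, fun h => iSup_le fun w => (h w).trans (mul_le_of_le_one_right' w.2)⟩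
  rw [pairing_le_iff_toReal hε]
  intro w hw
  have hs : ∀ s : ℝ, (J w).toReal < s → ⟪f, w⟫ / ε ≤ s := by
    intro s hs
    have hs0 : 0 < s := ENNReal.toReal_nonneg.trans_lt hs
    have hJ : J (s⁻¹ • w) ≤ 1 := by
      rw [hJhom _ (inv_pos.2 hs0), ← ENNReal.ofReal_toReal hw,
        ← ENNReal.ofReal_mul (by positivity), ENNReal.ofReal_le_one, inv_mul_le_iff₀ hs0, mul_one]
      exact hs.le
    have hle := (iSup_le_iff.1 h) ⟨s⁻¹ • w, hJ⟩
    rw [ENNReal.ofReal_le_ofReal_iff hε.le, real_inner_smul_right, inv_mul_le_iff₀ hs0] at hle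
    rwa [div_le_iff₀ hε]
  have := le_of_forall_gt_imp_ge_of_dense hs
  rwa [div_le_iff₀ hε, mul_comm] at this

end PositivelyHomogeneous

/-- For a positively one-homogeneous functional `J : H → [0,+∞]` on a real
inner product space, `ω = 0` minimizes `ω ↦ J(ω) + ‖ω - f‖²/(2ε)` iff
`ε ≥ ‖f‖_* = sup {⟨f,w⟩ : J w ≤ 1}`, iff `⟨f,w⟩ ≤ ε·J(w)` for all `w`. -/
theorem stmt_0 {H : Type*} [NormedAddCommGroup H] [InnerProductSpace ℝ H]
    (J : H → ℝ≥0∞) (hJ0 : J 0 = 0)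
    (hJhom : ∀ s : ℝ, 0 < s → ∀ w : H, J (s • w) = ENNReal.ofReal s * J w)
    (f : H) (ε : ℝ) (hε : 0 < ε) :
    ((∀ ω : H, J 0 + ENNReal.ofReal (‖(0 : H) - f‖ ^ 2 / (2 * ε)) ≤
        J ω + ENNReal.ofReal (‖ω - f‖ ^ 2 / (2 * ε))) ↔
      (⨆ w : {w : H // J w ≤ 1}, ENNReal.ofReal ⟪f, (w : H)⟫) ≤ ENNReal.ofReal ε) ∧
    ((∀ ω : H, J 0 + ENNReal.ofReal (‖(0 : H) - f‖ ^ 2 / (2 * ε)) ≤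
        J ω + ENNReal.ofReal (‖ω - f‖ ^ 2 / (2 * ε))) ↔
      ∀ w : H, ENNReal.ofReal ⟪f, w⟫ ≤ ENNReal.ofReal ε * J w) := by
  have h := zero_minimizes_iff_pairing_le (f := f) hJ0 hJhom hε
  exact ⟨h.trans (iSup_pairing_le_iff hJhom hε).symm, h⟩
end

section
/- Let N ≥ 1, let A ⊆ ℝ^N be open, let u0 ∈ L²(A;ℝ^N), and let u be a solution of the gradient flow of 𝒟 starting from u0. Then for every t > 0, u(t) is the unique minimizer over z ∈ L²(A;ℝ^N) of the functional z ↦ 𝒟(z) + (1/(2t))·∫_A |z − u0|² dx; that is, 𝒟(u(t)) + (1/(2t))‖u(t) − u0‖²_{L²} ≤ 𝒟(z) + (1/(2t))‖z − u0‖²_{L²} for every z, with equality only if z = u(t). -/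
open MeasureTheory Topology Filter Metric Set
open scoped ENNReal RealInnerProductSpace

noncomputable section

abbrev EN (N : ℕ) := EuclideanSpace ℝ (Fin N)

/-- Smooth test functions with compact support contained in `A`, bounded by 1. -/
def TestFn {N : ℕ} (A : Set (EN N)) (v : EN N → ℝ) : Prop :=
  ContDiff ℝ (⊤ : ℕ∞) v ∧ HasCompactSupport v ∧ tsupport v ⊆ A ∧ ∀ x, |v x| ≤ 1

/-- `𝒟(u)`: total mass of the distributional divergence of `u` on `A`. -/
def divTV {N : ℕ} (A : Set (EN N)) (u : EN N → EN N) : ℝ≥0∞ :=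
  ⨆ v : {v : EN N → ℝ // TestFn A v},
    ENNReal.ofReal (-∫ x in A, ⟪u x, gradient (v : EN N → ℝ) x⟫)

abbrev L2 {N : ℕ} (A : Set (EN N)) := Lp (EN N) 2 (volume.restrict A)

/-- `p ∈ ∂𝒟(u)` in `L²(A;ℝ^N)` (the subgradient inequality holds trivially
when `𝒟(z) = +∞`). -/
def InSubgradLp {N : ℕ} (A : Set (EN N)) (u p : L2 A) : Prop :=
  divTV A ⇑u ≠ ⊤ ∧ ∀ z : L2 A, divTV A ⇑z ≠ ⊤ →
    (divTV A ⇑u).toReal + ⟪p, z - u⟫ ≤ (divTV A ⇑z).toReal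

/-- A solution of the gradient flow of `𝒟` starting from `u0`: a continuous map
`u : [0,∞) → L²` with `u 0 = u0`, whose right derivative exists for `t > 0` and
satisfies `-∂⁺u(t) ∈ ∂𝒟(u(t))`. -/
def IsGradFlow {N : ℕ} (A : Set (EN N)) (u0 : L2 A) (u : ℝ → L2 A) : Prop :=
  ContinuousOn u (Ici 0) ∧ u 0 = u0 ∧
  ∀ t : ℝ, 0 < t → ∃ p : L2 A,
    Tendsto (fun h : ℝ => h⁻¹ • (u (t + h) - u t)) (𝓝[>] (0:ℝ)) (𝓝 p) ∧
    InSubgradLp A (u t) (-p)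

/-- A continuous curve moving with right velocity `-p t`, where `p t` is a point of `C` at which
the linear functional `⟪·, u t⟫` attains its maximum over `C`: the subgradient flow of the support
function of `C`. -/
structure SupportFlow {H : Type*} [NormedAddCommGroup H] [InnerProductSpace ℝ H]
    (C : Set H) (u p : ℝ → H) : Prop where
  cont : ContinuousOn u (Ici 0)
  mem : ∀ t, 0 < t → p t ∈ C
  deriv : ∀ t, 0 < t → HasDerivWithinAt u (-p t) (Ici t) t
  max : ∀ t, 0 < t → ∀ q ∈ C, ⟪q, u t⟫ ≤ ⟪p t, u t⟫

/-- If `p` maximizes `⟪·, x⟫` over `C`, then moving from `p` away from any `q ∈ C` by a small amount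
can be corrected to an almost maximizer of `⟪·, x⟫` in `C` without essentially increasing
the norm. -/
def HasTruncations {H : Type*} [NormedAddCommGroup H] [InnerProductSpace ℝ H]
    (C : Set H) : Prop :=
  ∀ x, ∀ p ∈ C, ∀ q ∈ C, (∀ q' ∈ C, ⟪q', x⟫ ≤ ⟪p, x⟫) → ∀ ε : ℝ, 0 < ε → ε ≤ 1 →
    ∀ η : ℝ, 0 < η → ∃ q' ∈ C, ‖q'‖ ≤ ‖p + ε • (p - q)‖ + η ∧ ⟪p, x⟫ - η ≤ ⟪q', x⟫

lemma le_apply_zero_of_forall_pos {f : ℝ → ℝ} (hf : Continuous f) {a : ℝ}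
    (h : ∀ δ, 0 < δ → a ≤ f δ) : a ≤ f 0 := by
  have h1 : Tendsto f (𝓝[>] 0) (𝓝 (f 0)) := (hf.tendsto 0).mono_left nhdsWithin_le_nhds
  exact ge_of_tendsto h1 (eventually_mem_nhdsWithin.mono h)

namespace SupportFlow

variable {H : Type*} [NormedAddCommGroup H] [InnerProductSpace ℝ H] {C : Set H} {u p : ℝ → H}

lemma tendsto_slope (h : SupportFlow C u p) {t : ℝ} (ht : 0 < t) :
    Tendsto (slope u t) (𝓝[>] t) (𝓝 (-p t)) :=
  (hasDerivWithinAt_iff_tendsto_slope' (by simp)).1 (h.deriv t ht).Ioi_of_Ici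

lemma continuousOn_Icc (h : SupportFlow C u p) {a b : ℝ} (ha : 0 ≤ a) :
    ContinuousOn u (Icc a b) :=
  h.cont.mono fun _ hx => ha.trans hx.1

/-- The right velocity is bounded by any right Lipschitz constant. -/
lemma norm_le_of_forall_gt (h : SupportFlow C u p) {t c : ℝ} (ht : 0 < t)
    (hc : ∀ τ, t < τ → ‖u τ - u t‖ ≤ c * (τ - t)) : ‖p t‖ ≤ c := by
  have h1 := (h.tendsto_slope ht).norm
  rw [norm_neg] at h1
  refine le_of_tendsto h1 (eventually_mem_nhdsWithin.mono fun τ (hτ : t < τ) => ?_)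
  have h2 : 0 < τ - t := sub_pos.2 hτ
  rw [slope_def_module, norm_smul, norm_inv, Real.norm_of_nonneg h2.le, inv_mul_le_iff₀ h2,
    mul_comm]
  exact hc τ hτ

/-- Mean value inequality along a fixed direction. -/
lemma inner_sub_le (h : SupportFlow C u p) {a b m : ℝ} {z : H} (ha : 0 ≤ a) (hab : a ≤ b)
    (hm : ∀ τ ∈ Ioo a b, ⟪p τ, z⟫ ≤ m) : ⟪u a - u b, z⟫ ≤ m * (b - a) := by
  rcases hab.eq_or_lt with rfl | hab
  · simp
  have key : ∀ a' ∈ Ioo a b, ⟪u a' - u b, z⟫ ≤ m * (b - a') := by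
    intro a' ha'
    have ha0 : 0 < a' := ha.trans_lt ha'.1
    have := image_le_of_deriv_right_le_deriv_boundary (f := fun τ => ⟪u a' - u τ, z⟫)
      (f' := fun τ => ⟪p τ, z⟫) (a := a') (b := b) (B := fun τ => m * (τ - a')) (B' := fun _ => m)
      ((continuousOn_const.sub (h.continuousOn_Icc ha0.le)).inner continuousOn_const)
      (fun x hx => by
        have := (((hasDerivWithinAt_const x (Ici x) (u a')).sub
          (h.deriv x (ha0.trans_le hx.1)))).inner ℝ (hasDerivWithinAt_const x (Ici x) z)
        simpa using this)
      (by simp) (by fun_prop)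
      (fun x _ => by
        simpa using (((hasDerivAt_id x).sub_const a').const_mul m).hasDerivWithinAt)
      (fun x hx => hm x ⟨ha'.1.trans_le hx.1, hx.2⟩) (right_mem_Icc.2 ha'.2.le)
    simpa using this
  have hu : Tendsto u (𝓝[>] a) (𝓝 (u a)) :=
    (h.cont a ha).mono_left (nhdsWithin_mono _ fun x (hx : a < x) => ha.trans hx.le)
  have h1 : Tendsto (fun a' => ⟪u a' - u b, z⟫) (𝓝[>] a) (𝓝 ⟪u a - u b, z⟫) :=
    (hu.sub tendsto_const_nhds).inner tendsto_const_nhds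
  have h2 : Tendsto (fun a' => m * (b - a')) (𝓝[>] a) (𝓝 (m * (b - a))) :=
    ((by fun_prop : Continuous fun a' : ℝ => m * (b - a')).tendsto a).mono_left nhdsWithin_le_nhds
  exact le_of_tendsto_of_tendsto h1 h2
    (mem_of_superset (Ioo_mem_nhdsGT hab) key)

/-- The speed of the flow is nonincreasing. -/
lemma norm_anti (h : SupportFlow C u p) {s t : ℝ} (hs : 0 < s) (hst : s ≤ t) :
    ‖p t‖ ≤ ‖p s‖ := by
  have key : ∀ k, 0 < k → ‖u (t + k) - u t‖ ≤ ‖u (s + k) - u s‖ := by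
    intro k hk
    have hd : ∀ x, 0 < x → HasDerivWithinAt (fun τ => u (τ + k) - u τ)
        (-p (x + k) - -p x) (Ici x) x := by
      intro x hx
      have h1 : HasDerivWithinAt (fun τ => u (τ + k)) (-p (x + k)) (Ici x) x := by
        have h2 : HasDerivWithinAt (fun τ : ℝ => τ + k) 1 (Ici x) x :=
          ((hasDerivAt_id x).add_const k).hasDerivWithinAt
        have := (h.deriv (x + k) (by linarith)).scomp x h2
          (fun y (hy : x ≤ y) => by simpa using hy)
        simpa [Function.comp_def] using this
      exact h1.sub (h.deriv x hx)
    have := image_le_of_deriv_right_le_deriv_boundary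
      (f := fun τ => ⟪u (τ + k) - u τ, u (τ + k) - u τ⟫)
      (f' := fun x => ⟪u (x + k) - u x, -p (x + k) - -p x⟫ + ⟪-p (x + k) - -p x, u (x + k) - u x⟫)
      (a := s) (b := t) (B := fun τ => ‖u (s + k) - u s‖ ^ 2) (B' := fun _ => 0)
      (by
        have h1 : ContinuousOn (fun τ => u (τ + k) - u τ) (Icc s t) := by
          refine ContinuousOn.sub (h.cont.comp (by fun_prop) fun x hx => ?_)
            (h.continuousOn_Icc hs.le)
          have : s ≤ x := hx.1
          simp only [mem_Ici]; linarith
        exact h1.inner h1)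
      (fun x hx => (hd x (hs.trans_le hx.1)).inner ℝ (hd x (hs.trans_le hx.1)))
      (by simp) (by fun_prop)
      (fun x _ => hasDerivWithinAt_const _ _ _)
      (fun x hx => by
        have hx0 : 0 < x := hs.trans_le hx.1
        have h1 := h.max x hx0 _ (h.mem (x + k) (by linarith))
        have h2 := h.max (x + k) (by linarith) _ (h.mem x hx0)
        rw [real_inner_comm]
        simp only [inner_sub_left, inner_sub_right, inner_neg_left] at *
        linarith) (right_mem_Icc.2 hst)
    simp only [real_inner_self_eq_norm_sq] at this
    exact le_of_sq_le_sq this (norm_nonneg _)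
  have aux : ∀ r, 0 < r → Tendsto (fun k => ‖k⁻¹ • (u (r + k) - u r)‖) (𝓝[>] 0) (𝓝 ‖p r‖) := by
    intro r hr
    have h1 : Tendsto (fun k : ℝ => r + k) (𝓝[>] 0) (𝓝[>] r) := by
      refine tendsto_nhdsWithin_iff.2 ⟨?_, eventually_mem_nhdsWithin.mono fun k (hk : 0 < k) => ?_⟩
      · have : Tendsto (fun k : ℝ => r + k) (𝓝 0) (𝓝 (r + 0)) :=
          (by fun_prop : Continuous fun k : ℝ => r + k).tendsto 0
        rw [add_zero] at this
        exact this.mono_left nhdsWithin_le_nhds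
      · simpa using hk
    have := ((h.tendsto_slope hr).comp h1).norm
    simpa [slope_def_module, Function.comp_def] using this
  refine le_of_tendsto_of_tendsto (aux t (hs.trans_le hst)) (aux s hs)
    (eventually_mem_nhdsWithin.mono fun k (hk : 0 < k) => ?_)
  simp only [norm_smul]
  exact mul_le_mul_of_nonneg_left (key k hk) (norm_nonneg _)

/-- The speed of the flow is bounded by the descending slope of the support function. -/
lemma norm_le_of_slope (h : SupportFlow C u p) {t c : ℝ} (ht : 0 < t) (hc : 0 ≤ c)
    (hE : ∀ τ, t ≤ τ → ⟪p t, u t⟫ ≤ ⟪p τ, u τ⟫ + c * ‖u τ - u t‖) : ‖p t‖ ≤ c := by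
  refine h.norm_le_of_forall_gt ht fun T hT => ?_
  have key : ∀ δ, 0 < δ → ‖u T - u t‖ ≤ (c + δ) * (T - t + δ) := by
    intro δ hδ
    have hd : ∀ x, 0 < x → HasDerivWithinAt (fun τ => u τ - u t) (-p x) (Ici x) x :=
      fun x hx => (h.deriv x hx).sub_const _
    have hcu : ContinuousOn (fun τ => u τ - u t) (Icc t T) :=
      (h.continuousOn_Icc ht.le).sub continuousOn_const
    have := image_le_of_liminf_slope_right_lt_deriv_boundary'
      (f := fun τ => ⟪u τ - u t, u τ - u t⟫)
      (f' := fun x => ⟪u x - u t, -p x⟫ + ⟪-p x, u x - u t⟫)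
      (a := t) (b := T) (B := fun τ => ((c + δ) * (τ - t + δ)) ^ 2)
      (B' := fun τ => 2 * ((c + δ) * (τ - t + δ)) * (c + δ))
      (hcu.inner hcu)
      (fun x hx r hr => by
        have hx0 : 0 < x := ht.trans_le hx.1
        exact ((hd x hx0).inner ℝ (hd x hx0)).liminf_right_slope_le hr)
      (by simp; positivity) (by fun_prop)
      (fun x _ => by
        have := ((((hasDerivAt_id x).sub_const t).add_const δ).const_mul (c + δ)).pow 2
        simpa [Pi.pow_def] using this.hasDerivWithinAt)
      (fun x hx hB => by
        have hx0 : 0 < x := ht.trans_le hx.1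
        have hpos : 0 < (c + δ) * (x - t + δ) :=
          mul_pos (by linarith) (by linarith [hx.1])
        simp only [real_inner_self_eq_norm_sq] at hB
        have hB' : ‖u x - u t‖ = (c + δ) * (x - t + δ) := by
          rwa [sq_eq_sq₀ (norm_nonneg _) hpos.le] at hB
        have h1 := h.max t ht _ (h.mem x hx0)
        have h2 := hE x hx.1
        rw [← hB', real_inner_comm]
        have h3 : ⟪-p x, u x - u t⟫ ≤ c * ‖u x - u t‖ := by
          simp only [inner_sub_right, inner_neg_left]
          linarith
        rw [← hB'] at hpos
        nlinarith) (right_mem_Icc.2 hT.le)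
    simp only [real_inner_self_eq_norm_sq] at this
    exact le_of_sq_le_sq this (mul_nonneg (by linarith) (by linarith))
  simpa using le_apply_zero_of_forall_pos (f := fun δ => (c + δ) * (T - t + δ)) (by fun_prop) key

/-- The velocity maximizes `⟪·, p t⟫` over `C`. -/
lemma inner_le_norm_sq (h : SupportFlow C u p) (hC : HasTruncations C) {t : ℝ} (ht : 0 < t)
    {q : H} (hq : q ∈ C) : ⟪q, p t⟫ ≤ ‖p t‖ ^ 2 := by
  have h1 : ∀ ε : ℝ, 0 < ε → ε ≤ 1 → ‖p t‖ ≤ ‖p t + ε • (p t - q)‖ := by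
    intro ε hε hε1
    refine h.norm_le_of_slope ht (norm_nonneg _) fun τ hτ => ?_
    have key : ∀ η, 0 < η → ⟪p t, u t⟫ ≤
        ⟪p τ, u τ⟫ + (‖p t + ε • (p t - q)‖ + η) * ‖u τ - u t‖ + η := by
      intro η hη
      obtain ⟨q', hq', hn, hi⟩ := hC (u t) (p t) (h.mem t ht) q hq (h.max t ht) ε hε hε1 η hη
      have h2 := h.max τ (ht.trans_le hτ) q' hq'
      have h3 : -⟪q', u τ - u t⟫ ≤ ‖q'‖ * ‖u τ - u t‖ :=
        (neg_le_abs _).trans (abs_real_inner_le_norm _ _)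
      have h4 := mul_le_mul_of_nonneg_right hn (norm_nonneg (u τ - u t))
      rw [inner_sub_right] at h3
      linarith
    simpa using le_apply_zero_of_forall_pos
      (f := fun η => ⟪p τ, u τ⟫ + (‖p t + ε • (p t - q)‖ + η) * ‖u τ - u t‖ + η)
      (by fun_prop) key
  have h2 : ∀ ε : ℝ, 0 < ε → ⟪q, p t⟫ ≤ ‖p t‖ ^ 2 + min ε 1 * ‖p t - q‖ ^ 2 / 2 := by
    intro ε hε
    have hm : 0 < min ε 1 := lt_min hε one_pos
    have h3 := pow_le_pow_left₀ (norm_nonneg _) (h1 (min ε 1) hm (min_le_right _ _)) 2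
    rw [norm_add_sq_real, norm_smul, inner_smul_right, Real.norm_of_nonneg hm.le,
      inner_sub_right, real_inner_self_eq_norm_sq, real_inner_comm] at h3
    have h4 : 0 ≤ min ε 1 * (‖p t‖ ^ 2 - ⟪q, p t⟫ + min ε 1 * ‖p t - q‖ ^ 2 / 2) := by
      nlinarith
    have := nonneg_of_mul_nonneg_right h4 hm
    linarith
  simpa using le_apply_zero_of_forall_pos
    (f := fun ε => ‖p t‖ ^ 2 + min ε 1 * ‖p t - q‖ ^ 2 / 2) (by fun_prop) h2

lemma continuousOn_energy (h : SupportFlow C u p) {a b : ℝ} (ha : 0 < a) :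
    ContinuousOn (fun t => ⟪p t, u t⟫) (Icc a b) := by
  have hle : ∀ s ∈ Icc a b, ∀ t ∈ Icc a b,
      ⟪p s, u s⟫ - ⟪p t, u t⟫ ≤ ‖p a‖ * ‖u s - u t‖ := by
    intro s hs t ht
    have h1 := h.max t (ha.trans_le ht.1) _ (h.mem s (ha.trans_le hs.1))
    have h2 := real_inner_le_norm (p s) (u s - u t)
    have h3 := mul_le_mul_of_nonneg_right (h.norm_anti ha hs.1) (norm_nonneg (u s - u t))
    rw [inner_sub_right] at h2
    linarith
  intro x hx
  have hu := (h.continuousOn_Icc ha.le (b := b)) x hx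
  have h0 : Tendsto (fun y => ‖p a‖ * ‖u y - u x‖) (𝓝[Icc a b] x) (𝓝 0) := by
    simpa using ((hu.sub_const (u x)).norm.const_mul ‖p a‖)
  refine tendsto_iff_norm_sub_tendsto_zero.2 (squeeze_zero' (Eventually.of_forall fun _ =>
    norm_nonneg _) (eventually_mem_nhdsWithin.mono fun y hy => ?_) h0)
  rw [Real.norm_eq_abs, abs_le]
  have h1 := hle y hy x hx
  have h2 := hle x hx y hy
  rw [norm_sub_rev] at h2
  constructor <;> linarith

/-- Every earlier velocity stays a maximizer of `⟪·, u t⟫` over `C`. -/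
lemma energy_le (h : SupportFlow C u p) (hC : HasTruncations C) {s t : ℝ} (hs : 0 < s)
    (hst : s ≤ t) : ⟪p t, u t⟫ ≤ ⟪p s, u t⟫ := by
  have key : ∀ δ, 0 < δ → ⟪p t, u t⟫ - ⟪p s, u t⟫ ≤ δ * (t - s) := by
    intro δ hδ
    refine image_le_of_liminf_slope_right_lt_deriv_boundary'
      (f := fun τ => ⟪p τ, u τ⟫ - ⟪p s, u τ⟫) (f' := fun _ => 0) (a := s) (b := t)
      (B := fun τ => δ * (τ - s)) (B' := fun _ => δ)
      ((h.continuousOn_energy hs).sub (continuousOn_const.inner (h.continuousOn_Icc hs.le)))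
      ?_ (by simp) (by fun_prop)
      (fun x _ => by
        simpa using (((hasDerivAt_id x).sub_const s).const_mul δ).hasDerivWithinAt)
      (fun _ _ _ => hδ) (right_mem_Icc.2 hst)
    intro x hx r hr
    have hx0 : 0 < x := hs.trans_le hx.1
    have hfreq : ∃ᶠ z in 𝓝[>] x, ‖p x‖ ^ 2 - r / 2 < ⟪p z, p x⟫ := by
      intro hev
      simp only [not_lt] at hev
      obtain ⟨b, hb, hsub⟩ := mem_nhdsGT_iff_exists_Ioo_subset.1 hev
      have h1 : Tendsto (fun y => -⟪slope u x y, p x⟫) (𝓝[>] x) (𝓝 (‖p x‖ ^ 2)) := by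
        have := ((h.tendsto_slope hx0).inner (𝕜 := ℝ) (tendsto_const_nhds (x := p x))).neg
        simpa [real_inner_self_eq_norm_sq] using this
      have h2 : ‖p x‖ ^ 2 ≤ ‖p x‖ ^ 2 - r / 2 := by
        refine le_of_tendsto h1 (mem_of_superset (Ioo_mem_nhdsGT hb) fun y hy => ?_)
        have h3 := h.inner_sub_le hx0.le hy.1.le (z := p x) (m := ‖p x‖ ^ 2 - r / 2)
          fun τ hτ => hsub ⟨hτ.1, hτ.2.trans hy.2⟩
        have hpos : 0 < y - x := sub_pos.2 hy.1
        rw [mem_ofPred_eq, slope_def_module, inner_smul_left, ← mul_neg, ← inner_neg_left, neg_sub]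
        simp only [conj_trivial]
        rwa [inv_mul_le_iff₀ hpos, mul_comm]
      linarith
    have hev : ∀ᶠ z in 𝓝[>] x, (‖p x‖ + ‖p s‖) * ‖slope u x z + p x‖ < r / 2 := by
      have h1 : Tendsto (fun z => (‖p x‖ + ‖p s‖) * ‖slope u x z + p x‖) (𝓝[>] x) (𝓝 0) := by
        simpa using ((h.tendsto_slope hx0).add_const (p x)).norm.const_mul (‖p x‖ + ‖p s‖)
      exact h1.eventually_lt_const (by linarith)
    refine (hfreq.and_eventually (hev.and eventually_mem_nhdsWithin)).mono ?_
    rintro z ⟨hz1, hz2, hz : x < z⟩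
    have hpos : 0 < z - x := sub_pos.2 hz
    have h1 := h.max x hx0 _ (h.mem z (hx0.trans hz))
    have h2 : slope (fun τ => ⟪p τ, u τ⟫ - ⟪p s, u τ⟫) x z ≤ ⟪p z - p s, slope u x z⟫ := by
      rw [slope_def_module, slope_def_module, inner_smul_right, smul_eq_mul]
      refine mul_le_mul_of_nonneg_left ?_ (inv_nonneg.2 hpos.le)
      simp only [inner_sub_left, inner_sub_right]
      linarith
    have h3 : ⟪p z - p s, slope u x z + p x⟫ ≤ (‖p x‖ + ‖p s‖) * ‖slope u x z + p x‖ := by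
      refine (real_inner_le_norm _ _).trans (mul_le_mul_of_nonneg_right ?_ (norm_nonneg _))
      exact (norm_sub_le _ _).trans (by gcongr; exact h.norm_anti hx0 hz.le)
    have h4 := h.inner_le_norm_sq hC hx0 (h.mem s hs)
    have h5 : ⟪p z - p s, slope u x z + p x⟫ =
        ⟪p z - p s, slope u x z⟫ + (⟪p z, p x⟫ - ⟪p s, p x⟫) := by
      rw [inner_add_right, inner_sub_left (p z) (p s) (p x)]
    linarith
  have := le_apply_zero_of_forall_pos (f := fun δ => δ * (t - s)) (by fun_prop) key
  simp only [zero_mul] at this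
  linarith

/-- The averaged velocity `(u 0 - u t) / t` is a subgradient at `u t` of the support function
of `C`. -/
lemma mul_energy_add_inner_le (h : SupportFlow C u p) (hC : HasTruncations C) {t m : ℝ}
    (ht : 0 < t) {z : H} (hz : ∀ q ∈ C, ⟪q, z⟫ ≤ m) :
    t * ⟪p t, u t⟫ + ⟪u 0 - u t, z - u t⟫ ≤ t * m := by
  have h1 := h.inner_sub_le le_rfl ht.le (z := z) (m := m) fun τ hτ => hz _ (h.mem τ hτ.1)
  have h2 := h.inner_sub_le le_rfl ht.le (z := -u t) (m := -⟪p t, u t⟫) fun τ hτ => by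
    rw [inner_neg_right]
    exact neg_le_neg (h.energy_le hC hτ.1 hτ.2.le)
  rw [inner_neg_right] at h2
  rw [inner_sub_right]
  linarith

end SupportFlow

/-- A smooth approximation of the truncation of a real number to `[-1, 1]`. -/
def softClamp (δ x : ℝ) : ℝ := (√((x + 1) ^ 2 + δ ^ 2) - √((x - 1) ^ 2 + δ ^ 2)) / 2

lemma softClamp_zero (δ : ℝ) : softClamp δ 0 = 0 := by simp [softClamp]

lemma contDiff_softClamp {δ : ℝ} (hδ : 0 < δ) : ContDiff ℝ (⊤ : ℕ∞) (softClamp δ) := by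
  have h : ∀ c : ℝ, ContDiff ℝ (⊤ : ℕ∞) fun x : ℝ => √((x + c) ^ 2 + δ ^ 2) := fun c =>
    ContDiff.sqrt (by fun_prop) fun x => by positivity
  exact ((h 1).sub (by simpa [sub_eq_add_neg] using h (-1))).div_const 2

lemma abs_sqrt_sub_abs_le {δ : ℝ} (hδ : 0 < δ) (y : ℝ) :
    |y| ≤ √(y ^ 2 + δ ^ 2) ∧ √(y ^ 2 + δ ^ 2) ≤ |y| + δ := by
  constructor
  · exact Real.le_sqrt_of_sq_le (by rw [sq_abs]; nlinarith)
  · rw [Real.sqrt_le_left (by positivity)]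
    nlinarith [sq_abs y, mul_nonneg (abs_nonneg y) hδ.le]

lemma abs_deriv_softClamp_le {δ : ℝ} (hδ : 0 < δ) (x : ℝ) : |deriv (softClamp δ) x| ≤ 1 := by
  have h : ∀ c : ℝ, HasDerivAt (fun x : ℝ => √((x + c) ^ 2 + δ ^ 2))
      ((x + c) / √((x + c) ^ 2 + δ ^ 2)) x := by
    intro c
    have h1 : HasDerivAt (fun x : ℝ => (x + c) ^ 2 + δ ^ 2) (2 * (x + c)) x := by
      simpa [Pi.pow_def] using (((hasDerivAt_id x).add_const c).pow 2).add_const (δ ^ 2)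
    have := h1.sqrt (by positivity)
    rwa [mul_div_mul_left _ _ two_ne_zero] at this
  have hb : ∀ y : ℝ, |y / √(y ^ 2 + δ ^ 2)| ≤ 1 := by
    intro y
    rw [abs_div, abs_of_nonneg (Real.sqrt_nonneg _)]
    exact div_le_one_of_le₀ (abs_sqrt_sub_abs_le hδ y).1 (Real.sqrt_nonneg _)
  have hd := ((h 1).sub (h (-1))).div_const 2
  have he : deriv (softClamp δ) x = _ := hd.deriv
  rw [he, abs_div, abs_two, div_le_one two_pos]
  exact (abs_sub _ _).trans (by linarith [hb (x + 1), hb (x + -1)])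

lemma abs_softClamp_le_one {δ : ℝ} (x : ℝ) : |softClamp δ x| ≤ 1 := by
  have h : ∀ a b : ℝ, √(a ^ 2 + δ ^ 2) ≤ √(b ^ 2 + δ ^ 2) + |a - b| := by
    intro a b
    rw [Real.sqrt_le_left (by positivity)]
    have h1 := Real.sq_sqrt (show 0 ≤ b ^ 2 + δ ^ 2 by positivity)
    have h2 : |b| ≤ √(b ^ 2 + δ ^ 2) := Real.le_sqrt_of_sq_le (by rw [sq_abs]; nlinarith)
    have h3 : b * (a - b) ≤ √(b ^ 2 + δ ^ 2) * |a - b| :=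
      (le_abs_self _).trans (by rw [abs_mul]; gcongr)
    nlinarith [sq_abs (a - b)]
  have h1 := h (x + 1) (x - 1)
  have h2 := h (x - 1) (x + 1)
  rw [show x + 1 - (x - 1) = 2 by ring, abs_two] at h1
  rw [show x - 1 - (x + 1) = -2 by ring, abs_neg, abs_two] at h2
  rw [softClamp, abs_le]
  constructor <;> linarith

lemma abs_two_mul_sub_softClamp_le {δ ε v w : ℝ} (hδ : 0 < δ) (hε : 0 < ε) (hε1 : ε ≤ 1)
    (hv : |v| ≤ 1) (hw : |w| ≤ 1) : |2 * v - softClamp δ (v + ε * (v - w))| ≤ 1 + δ := by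
  rw [abs_le] at hv hw
  have he1 : ε * (v - w) ≤ 1 + v := by nlinarith
  have he2 : -(1 - v) ≤ ε * (v - w) := by nlinarith
  generalize ε * (v - w) = e at he1 he2
  obtain ⟨h1, h2⟩ := abs_sqrt_sub_abs_le hδ (v + e + 1)
  obtain ⟨h3, h4⟩ := abs_sqrt_sub_abs_le hδ (v + e - 1)
  rw [softClamp, abs_le]
  rcases abs_cases (v + e + 1) with ⟨h5, h6⟩ | ⟨h5, h6⟩ <;>
  rcases abs_cases (v + e - 1) with ⟨h7, h8⟩ | ⟨h7, h8⟩ <;>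
  constructor <;> linarith

/-- Smooth functions with compact support contained in `A`. -/
def SmoothSupportedIn {N : ℕ} (A : Set (EN N)) (v : EN N → ℝ) : Prop :=
  ContDiff ℝ (⊤ : ℕ∞) v ∧ HasCompactSupport v ∧ tsupport v ⊆ A

namespace SmoothSupportedIn

variable {N : ℕ} {A : Set (EN N)} {v w : EN N → ℝ}

lemma comp {φ : ℝ → ℝ} (hv : SmoothSupportedIn A v) (hφ : ContDiff ℝ (⊤ : ℕ∞) φ)
    (h0 : φ 0 = 0) : SmoothSupportedIn A (φ ∘ v) :=
  ⟨hφ.comp hv.1, hv.2.1.comp_left h0, (tsupport_comp_subset h0 v).trans hv.2.2⟩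

lemma const_mul (hv : SmoothSupportedIn A v) (a : ℝ) : SmoothSupportedIn A fun x => a * v x :=
  hv.comp (φ := fun y => a * y) (by fun_prop) (mul_zero a)

lemma add (hv : SmoothSupportedIn A v) (hw : SmoothSupportedIn A w) :
    SmoothSupportedIn A fun x => v x + w x :=
  ⟨hv.1.add hw.1, hv.2.1.add hw.2.1, (tsupport_add v w).trans (union_subset hv.2.2 hw.2.2)⟩

lemma hasGradientAt (hv : SmoothSupportedIn A v) (x : EN N) :
    HasGradientAt v (gradient v x) x :=
  (hv.1.differentiable (by simp) x).hasGradientAt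

lemma gradient_comp {φ : ℝ → ℝ} (hv : SmoothSupportedIn A v) (hφ : ContDiff ℝ (⊤ : ℕ∞) φ)
    (x : EN N) : gradient (φ ∘ v) x = deriv φ (v x) • gradient v x := by
  refine HasGradientAt.gradient ?_
  rw [hasGradientAt_iff_hasFDerivAt, map_smulₛₗ]
  exact (hφ.differentiable (by simp) (v x)).hasDerivAt.comp_hasFDerivAt x
    (hv.hasGradientAt x).hasFDerivAt

lemma gradient_linear_comb (hv : SmoothSupportedIn A v) (hw : SmoothSupportedIn A w) (a b : ℝ)
    (x : EN N) : gradient (fun x => a * v x + b * w x) x = a • gradient v x + b • gradient w x := by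
  refine HasGradientAt.gradient ?_
  rw [hasGradientAt_iff_hasFDerivAt, map_add, map_smulₛₗ, map_smulₛₗ]
  exact ((hv.hasGradientAt x).hasFDerivAt.const_mul a).add
    ((hw.hasGradientAt x).hasFDerivAt.const_mul b)

lemma memLp_gradient (hv : SmoothSupportedIn A v) :
    MemLp (gradient v) 2 (volume.restrict A) := by
  have h1 : Continuous (gradient v) :=
    (InnerProductSpace.toDual ℝ (EN N)).symm.continuous.comp (hv.1.continuous_fderiv (by simp))
  have h2 : HasCompactSupport (gradient v) :=
    (hv.2.1.fderiv ℝ).comp_left (map_zero (InnerProductSpace.toDual ℝ (EN N)).symm)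
  exact h1.memLp_of_hasCompactSupport h2

end SmoothSupportedIn

lemma testFn_iff {N : ℕ} {A : Set (EN N)} {v : EN N → ℝ} :
    TestFn A v ↔ SmoothSupportedIn A v ∧ ∀ x, |v x| ≤ 1 := by
  simp [TestFn, SmoothSupportedIn, and_assoc]

/-- The gradients of test functions, as elements of `L²`. -/
def gradientSet {N : ℕ} (A : Set (EN N)) : Set (L2 A) :=
  {g | ∃ v, TestFn A v ∧ ⇑g =ᵐ[volume.restrict A] gradient v}

section gradientSet

variable {N : ℕ} {A : Set (EN N)}

lemma TestFn.exists_mem_gradientSet {v : EN N → ℝ} (hv : TestFn A v) :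
    ∃ g ∈ gradientSet A, ⇑g =ᵐ[volume.restrict A] gradient v := by
  have h := (testFn_iff.1 hv).1.memLp_gradient.coeFn_toLp
  exact ⟨_, ⟨v, hv, h⟩, h⟩

lemma smul_add_smul_mem_gradientSet {a b : ℝ} (hab : |a| + |b| ≤ 1) {f g : L2 A}
    (hf : f ∈ gradientSet A) (hg : g ∈ gradientSet A) : a • f + b • g ∈ gradientSet A := by
  obtain ⟨v, hv, hfv⟩ := hf
  obtain ⟨w, hw, hgw⟩ := hg
  rw [testFn_iff] at hv hw
  refine ⟨fun x => a * v x + b * w x, testFn_iff.2 ⟨(hv.1.const_mul a).add (hw.1.const_mul b),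
    fun x => ?_⟩, ?_⟩
  · refine (abs_add_le _ _).trans ?_
    rw [abs_mul, abs_mul]
    nlinarith [hv.2 x, hw.2 x, abs_nonneg a, abs_nonneg b]
  · filter_upwards [Lp.coeFn_add (a • f) (b • g), Lp.coeFn_smul a f, Lp.coeFn_smul b g, hfv, hgw]
      with x h1 h2 h3 h4 h5
    rw [h1, hv.1.gradient_linear_comb hw.1, Pi.add_apply, h2, h3, Pi.smul_apply, Pi.smul_apply,
      h4, h5]

lemma zero_mem_gradientSet : (0 : L2 A) ∈ gradientSet A := by
  have hv : TestFn A fun _ => 0 :=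
    ⟨contDiff_const, HasCompactSupport.zero, by simp [tsupport], by simp⟩
  obtain ⟨g, hg, -⟩ := hv.exists_mem_gradientSet
  simpa using smul_add_smul_mem_gradientSet (a := 0) (b := 0) (by simp) hg hg

lemma neg_mem_gradientSet {g : L2 A} (hg : g ∈ gradientSet A) : -g ∈ gradientSet A := by
  simpa using smul_add_smul_mem_gradientSet (a := -1) (b := 0) (by simp) hg hg

lemma convex_gradientSet : Convex ℝ (gradientSet A) :=
  fun _ hf _ hg a b ha hb hab => smul_add_smul_mem_gradientSet
    (by rw [abs_of_nonneg ha, abs_of_nonneg hb, hab]) hf hg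

lemma inner_eq_integral {g z : L2 A} {v : EN N → ℝ}
    (h : ⇑g =ᵐ[volume.restrict A] gradient v) : ⟪g, z⟫ = ∫ x in A, ⟪z x, gradient v x⟫ := by
  rw [real_inner_comm, L2.inner_def]
  refine integral_congr_ae ?_
  filter_upwards [h] with x hx
  rw [hx]

lemma divTV_le {z : L2 A} {m : ℝ} (h : ∀ g ∈ gradientSet A, ⟪g, z⟫ ≤ m) :
    divTV A ⇑z ≤ ENNReal.ofReal m := by
  refine iSup_le fun ⟨v, hv⟩ => ENNReal.ofReal_le_ofReal ?_
  obtain ⟨g, hg, hgv⟩ := hv.exists_mem_gradientSet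
  rw [← inner_eq_integral hgv, ← inner_neg_left]
  exact h _ (neg_mem_gradientSet hg)

lemma inner_le_toReal_divTV {z : L2 A} (hz : divTV A ⇑z ≠ ⊤) {g : L2 A}
    (hg : g ∈ closure (gradientSet A)) : ⟪g, z⟫ ≤ (divTV A ⇑z).toReal := by
  have key : gradientSet A ⊆ {g | ⟪g, z⟫ ≤ (divTV A ⇑z).toReal} := by
    intro g hg
    obtain ⟨v, hv, hgv⟩ := neg_mem_gradientSet hg
    rw [mem_ofPred_eq, ← neg_neg g, inner_neg_left, inner_eq_integral hgv]
    refine (ENNReal.ofReal_le_iff_le_toReal hz).1 ?_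
    exact le_iSup (fun v : {v : EN N → ℝ // TestFn A v} =>
      ENNReal.ofReal (-∫ x in A, ⟪z x, gradient (v : EN N → ℝ) x⟫)) ⟨v, hv⟩
  exact closure_minimal key (isClosed_le (by fun_prop) continuous_const) hg

/-- A subgradient of `𝒟` at `u` is a point of the closed set of gradients of test functions that
realizes `𝒟(u)`. -/
lemma InSubgradLp.mem_closure_and_inner_eq {u p : L2 A} (h : InSubgradLp A u p) :
    p ∈ closure (gradientSet A) ∧ ⟪p, u⟫ = (divTV A ⇑u).toReal := by
  obtain ⟨hu, h⟩ := h
  have htest : ∀ (z : L2 A) (m : ℝ), 0 ≤ m → (∀ g ∈ gradientSet A, ⟪g, z⟫ ≤ m) →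
      (divTV A ⇑u).toReal + ⟪p, z - u⟫ ≤ m := by
    intro z m hm hz
    have hle := divTV_le hz
    exact (h z (hle.trans_lt ENNReal.ofReal_lt_top).ne).trans
      (ENNReal.toReal_le_of_le_ofReal hm hle)
  have hscale : ∀ (c : ℝ), 0 ≤ c →
      (divTV A ⇑u).toReal + ⟪p, c • u - u⟫ ≤ c * (divTV A ⇑u).toReal := by
    intro c hc
    refine htest _ _ (by positivity) fun g hg => ?_
    rw [inner_smul_right]
    exact mul_le_mul_of_nonneg_left (inner_le_toReal_divTV hu (subset_closure hg)) hc
  have h0 := hscale 0 le_rfl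
  have h2 := hscale 2 zero_le_two
  simp only [inner_sub_right, inner_smul_right] at h0 h2
  have heq : ⟪p, u⟫ = (divTV A ⇑u).toReal := by linarith
  refine ⟨by_contra fun hp => ?_, heq⟩
  obtain ⟨f, m, hf, hm⟩ :=
    geometric_hahn_banach_closed_point convex_gradientSet.closure isClosed_closure hp
  set z := (InnerProductSpace.toDual ℝ (L2 A)).symm f with hz
  have hfz : ∀ y, f y = ⟪y, z⟫ := fun y => by
    rw [real_inner_comm, hz, InnerProductSpace.toDual_symm_apply]
  have hm0 : 0 < m := by
    simpa using hf 0 (subset_closure zero_mem_gradientSet)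
  have h3 := htest z m hm0.le fun g hg => by
    rw [← hfz]
    exact (hf g (subset_closure hg)).le
  rw [hfz] at hm
  rw [inner_sub_right] at h3
  linarith

/-- Truncating `P + ε • (P - Q)` at the level of potentials. -/
lemma exists_truncation {P Q : L2 A} (hP : P ∈ gradientSet A) (hQ : Q ∈ gradientSet A)
    {ε δ : ℝ} (hε : 0 < ε) (hε1 : ε ≤ 1) (hδ : 0 < δ) :
    ∃ S ∈ gradientSet A, ∃ R ∈ gradientSet A,
      ‖S‖ ≤ ‖P + ε • (P - Q)‖ ∧ S = (2 : ℝ) • P - (1 + δ) • R := by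
  obtain ⟨v, hv, hPv⟩ := hP
  obtain ⟨w, hw, hQw⟩ := hQ
  rw [testFn_iff] at hv hw
  set g : EN N → ℝ := fun x => (1 + ε) * v x + (-ε) * w x with hg
  have hgs : SmoothSupportedIn A g := (hv.1.const_mul _).add (hw.1.const_mul _)
  have hss := hgs.comp (contDiff_softClamp hδ) (softClamp_zero δ)
  have hs : TestFn A (softClamp δ ∘ g) := testFn_iff.2 ⟨hss, fun x => abs_softClamp_le_one _⟩
  have hδ1 : 0 < 1 + δ := by linarith
  have hr : TestFn A fun x =>
      ((1 + δ)⁻¹ * 2) * v x + (-(1 + δ)⁻¹) * (softClamp δ ∘ g) x := by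
    refine testFn_iff.2 ⟨(hv.1.const_mul _).add (hss.const_mul _), fun x => ?_⟩
    have := abs_two_mul_sub_softClamp_le hδ hε hε1 (hv.2 x) (hw.2 x)
    have hgx : g x = v x + ε * (v x - w x) := by rw [hg]; ring
    rw [Function.comp_apply, hgx, mul_assoc, neg_mul, ← sub_eq_add_neg, ← mul_sub, abs_mul,
      abs_of_pos (inv_pos.2 hδ1), inv_mul_le_iff₀ hδ1, mul_one]
    exact this
  obtain ⟨S, hS, hSs⟩ := hs.exists_mem_gradientSet
  obtain ⟨R, hR, hRr⟩ := hr.exists_mem_gradientSet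
  refine ⟨S, hS, R, hR, Lp.norm_le_norm_of_ae_le ?_, Lp.ext ?_⟩
  · filter_upwards [hSs, hPv, hQw, Lp.coeFn_add P (ε • (P - Q)), Lp.coeFn_smul ε (P - Q),
      Lp.coeFn_sub P Q] with x h1 h2 h3 h4 h5 h6
    rw [h1, h4, Pi.add_apply, h5, Pi.smul_apply, h6, Pi.sub_apply, h2, h3,
      hgs.gradient_comp (contDiff_softClamp hδ), hg, hv.1.gradient_linear_comb hw.1, norm_smul]
    refine (mul_le_of_le_one_left (norm_nonneg _) (abs_deriv_softClamp_le hδ _)).trans_eq ?_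
    congr 1
    module
  · filter_upwards [hSs, hPv, hRr, Lp.coeFn_sub ((2 : ℝ) • P) ((1 + δ) • R),
      Lp.coeFn_smul (2 : ℝ) P, Lp.coeFn_smul (1 + δ) R] with x h1 h2 h3 h4 h5 h6
    rw [h4, Pi.sub_apply, h5, h6, Pi.smul_apply, Pi.smul_apply, h1, h2, h3,
      hv.1.gradient_linear_comb hss, smul_add, smul_smul, smul_smul, mul_neg, ← mul_assoc,
      mul_inv_cancel₀ hδ1.ne']
    module

lemma hasTruncations_closure_gradientSet : HasTruncations (closure (gradientSet A)) := by
  intro x p hp q hq hmax ε hε hε1 η hη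
  have hpos : 0 < 3 + 2 * ‖x‖ + ‖p‖ * ‖x‖ := by positivity
  set δ := η / (3 + 2 * ‖x‖ + ‖p‖ * ‖x‖) with hδ_def
  have hδ : 0 < δ := div_pos hη hpos
  have hδη : δ * 3 + δ * (2 * ‖x‖) + δ * (‖p‖ * ‖x‖) = η := by
    rw [← mul_add, ← mul_add, hδ_def, div_mul_cancel₀ _ hpos.ne']
  have hx1 : 0 ≤ δ * (2 * ‖x‖) := by positivity
  have hx2 : 0 ≤ δ * (‖p‖ * ‖x‖) := by positivity
  obtain ⟨P, hP, hpP⟩ := Metric.mem_closure_iff.1 hp δ hδ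
  obtain ⟨Q, hQ, hqQ⟩ := Metric.mem_closure_iff.1 hq δ hδ
  rw [dist_eq_norm] at hpP hqQ
  obtain ⟨S, hS, R, hR, hSn, hSR⟩ := exists_truncation hP hQ hε hε1 hδ
  refine ⟨S, subset_closure hS, ?_, ?_⟩
  · have h1 : P + ε • (P - Q) =
        (p + ε • (p - q)) + ((-(1 + ε)) • (p - P) + ε • (q - Q)) := by module
    have h2 : ‖(-(1 + ε)) • (p - P) + ε • (q - Q)‖ ≤ 3 * δ := by
      refine (norm_add_le _ _).trans ?_
      rw [norm_smul, norm_smul, norm_neg, Real.norm_of_nonneg hε.le,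
        Real.norm_of_nonneg (by linarith : 0 ≤ 1 + ε)]
      nlinarith [norm_nonneg (p - P), norm_nonneg (q - Q)]
    have h3 := norm_add_le (p + ε • (p - q)) ((-(1 + ε)) • (p - P) + ε • (q - Q))
    rw [← h1] at h3
    linarith
  · have h1 := hmax R (subset_closure hR)
    have h2 : ⟪p - P, x⟫ ≤ δ * ‖x‖ :=
      (real_inner_le_norm _ _).trans (mul_le_mul_of_nonneg_right hpP.le (norm_nonneg _))
    have h3 := mul_le_mul_of_nonneg_left (real_inner_le_norm p x) hδ.le
    have h4 := mul_le_mul_of_nonneg_left h1 (by linarith : 0 ≤ 1 + δ)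
    rw [inner_sub_left] at h2
    rw [hSR, inner_sub_left, inner_smul_left, inner_smul_left]
    simp only [conj_trivial]
    linarith

end gradientSet

lemma IsGradFlow.exists_supportFlow {N : ℕ} {A : Set (EN N)} {u0 : L2 A} {u : ℝ → L2 A}
    (hu : IsGradFlow A u0 u) : ∃ p : ℝ → L2 A, SupportFlow (closure (gradientSet A)) u p ∧
      ∀ t, 0 < t → divTV A ⇑(u t) = ENNReal.ofReal ⟪p t, u t⟫ := by
  obtain ⟨hc, -, hd⟩ := hu
  choose! d hd hsub using hd
  refine ⟨fun t => -d t, ⟨hc, fun t ht => (hsub t ht).mem_closure_and_inner_eq.1, fun t ht => ?_,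
    fun t ht q hq => ?_⟩, fun t ht => ?_⟩
  · rw [neg_neg, ← hasDerivWithinAt_Ioi_iff_Ici, hasDerivWithinAt_iff_tendsto_slope' (by simp)]
    have h1 : Tendsto (fun τ : ℝ => τ - t) (𝓝[>] t) (𝓝[>] 0) := by
      refine tendsto_nhdsWithin_iff.2 ⟨?_, eventually_mem_nhdsWithin.mono fun k (hk : t < k) => ?_⟩
      · have : Tendsto (fun k : ℝ => k - t) (𝓝 t) (𝓝 (t - t)) :=
          (by fun_prop : Continuous fun k : ℝ => k - t).tendsto t
        rw [sub_self] at this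
        exact this.mono_left nhdsWithin_le_nhds
      · simpa using hk
    have := (hd t ht).comp h1
    simpa [Function.comp_def, slope_fun_def] using this
  · rw [(hsub t ht).mem_closure_and_inner_eq.2]
    exact inner_le_toReal_divTV (hsub t ht).1 hq
  · rw [(hsub t ht).mem_closure_and_inner_eq.2, ENNReal.ofReal_toReal (hsub t ht).1]

/-- The minimality of `u t` with a quadratic remainder. -/
lemma IsGradFlow.energy_add_le {N : ℕ} {A : Set (EN N)} {u0 : L2 A} {u : ℝ → L2 A}
    (hu : IsGradFlow A u0 u) {t : ℝ} (ht : 0 < t) (z : L2 A) :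
    divTV A ⇑(u t) + ENNReal.ofReal (‖u t - u0‖ ^ 2 / (2 * t)) +
        ENNReal.ofReal (‖z - u t‖ ^ 2 / (2 * t)) ≤
      divTV A ⇑z + ENNReal.ofReal (‖z - u0‖ ^ 2 / (2 * t)) := by
  by_cases hz : divTV A ⇑z = ⊤
  · simp [hz]
  obtain ⟨p, hp, hE⟩ := hu.exists_supportFlow
  have h1 := hp.mul_energy_add_inner_le hasTruncations_closure_gradientSet ht
    fun q hq => inner_le_toReal_divTV hz hq
  rw [hu.2.1] at h1
  have hE0 : 0 ≤ ⟪p t, u t⟫ := by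
    simpa using hp.max t ht 0 (subset_closure zero_mem_gradientSet)
  rw [hE t ht, ← ENNReal.ofReal_toReal hz, ← ENNReal.ofReal_add hE0 (by positivity),
    ← ENNReal.ofReal_add (by positivity) (by positivity),
    ← ENNReal.ofReal_add ENNReal.toReal_nonneg (by positivity)]
  refine ENNReal.ofReal_le_ofReal ?_
  have h2 : ‖z - u0‖ ^ 2 = ‖z - u t‖ ^ 2 - 2 * ⟪u0 - u t, z - u t⟫ + ‖u t - u0‖ ^ 2 := by
    rw [show z - u0 = (z - u t) - (u0 - u t) by abel, norm_sub_sq_real, norm_sub_rev u0,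
      real_inner_comm]
  rw [h2]
  field_simp
  linarith

/-- for every `t > 0`, `u(t)` is the unique minimizer of
`z ↦ 𝒟(z) + ‖z - u0‖²/(2t)`. -/
theorem stmt_4 {N : ℕ} (hN : 1 ≤ N) (A : Set (EN N)) (hA : IsOpen A)
    (u0 : L2 A) (u : ℝ → L2 A) (hu : IsGradFlow A u0 u) (t : ℝ) (ht : 0 < t) :
    (∀ z : L2 A,
      divTV A ⇑(u t) + ENNReal.ofReal (‖u t - u0‖ ^ 2 / (2 * t)) ≤
        divTV A ⇑z + ENNReal.ofReal (‖z - u0‖ ^ 2 / (2 * t))) ∧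
    (∀ z : L2 A,
      divTV A ⇑z + ENNReal.ofReal (‖z - u0‖ ^ 2 / (2 * t)) =
        divTV A ⇑(u t) + ENNReal.ofReal (‖u t - u0‖ ^ 2 / (2 * t)) → z = u t) := by
  have htop : divTV A ⇑(u t) + ENNReal.ofReal (‖u t - u0‖ ^ 2 / (2 * t)) ≠ ⊤ := by
    obtain ⟨p, -, hE⟩ := hu.exists_supportFlow
    rw [hE t ht]
    exact ENNReal.add_ne_top.2 ⟨ENNReal.ofReal_ne_top, ENNReal.ofReal_ne_top⟩
  refine ⟨fun z => le_self_add.trans (hu.energy_add_le ht z), fun z hz => ?_⟩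
  have h1 := hu.energy_add_le ht z
  rw [hz] at h1
  have h2 : ENNReal.ofReal (‖z - u t‖ ^ 2 / (2 * t)) ≤ 0 :=
    (ENNReal.add_le_add_iff_left htop).1 (by simpa using h1)
  rw [nonpos_iff_eq_zero, ENNReal.ofReal_eq_zero, div_le_iff₀ (by positivity), zero_mul] at h2
  have h3 : ‖z - u t‖ = 0 := by
    simpa using le_antisymm h2 (sq_nonneg _)
  exact sub_eq_zero.1 (norm_eq_zero.1 h3)
end
end

section
/- Let N ≥ 1, let A ⊆ ℝ^N be open, let δ > 0, and let u0 ∈ L²(A;ℝ^N) with div u0 = μ0 for a finite signed Borel measure μ0 on A. Let u be a minimizer over z ∈ L²(A;ℝ^N) of z ↦ 𝒟(z) + (1/(2δ))∫_A |z − u0|² dx, and suppose div u = μ for a finite signed Borel measure μ on A. Then μ ≪ μ0 and, for the Jordan decompositions, μ^+ ≤ μ0^+ and μ^- ≤ μ0^-. -/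
open MeasureTheory Topology Filter Metric Set
open scoped ENNReal RealInnerProductSpace

noncomputable section

/-- `div u = μ` in the distributional sense on `A`. -/
def DivEq {N : ℕ} (A : Set (EN N)) (u : EN N → EN N) (μ : SignedMeasure (EN N)) : Prop :=
  ∀ φ : EN N → ℝ, ContDiff ℝ (⊤ : ℕ∞) φ → HasCompactSupport φ → tsupport φ ⊆ A →
    ∫ x in A, ⟪u x, gradient φ x⟫ =
      -((∫ x, φ x ∂μ.toJordanDecomposition.posPart) -
        ∫ x, φ x ∂μ.toJordanDecomposition.negPart)

/-- `u` has distributional divergence `a - b` on `A`, tested against the `L²` class of `∇φ`. -/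
def HasDivParts {N : ℕ} (A : Set (EN N)) (u : L2 A) (a b : Measure (EN N)) : Prop :=
  ∀ φ : EN N → ℝ, ContDiff ℝ (⊤ : ℕ∞) φ → HasCompactSupport φ → tsupport φ ⊆ A →
    ∀ h : L2 A, ⇑h =ᵐ[volume.restrict A] gradient φ →
      ⟪u, h⟫ = -((∫ x, φ x ∂a) - ∫ x, φ x ∂b)

/-- The `L²` classes of the gradients of admissible test functions. -/
def testGradients {N : ℕ} (A : Set (EN N)) : Set (L2 A) :=
  {f | ∃ v, TestFn A v ∧ ⇑f =ᵐ[volume.restrict A] gradient v}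

section Hilbert

variable {H : Type*} [NormedAddCommGroup H] [InnerProductSpace ℝ H]

theorem nonneg_of_forall_pos_le_one_add_mul {c M : ℝ}
    (h : ∀ t : ℝ, 0 < t → t ≤ 1 → 0 ≤ c + t * M) : 0 ≤ c := by
  have hlim : Tendsto (fun t : ℝ => c + t * M) (𝓝[>] 0) (𝓝 c) := by
    have : Continuous fun t : ℝ => c + t * M := by fun_prop
    simpa using (this.tendsto 0).mono_left nhdsWithin_le_nhds
  refine ge_of_tendsto hlim ?_
  filter_upwards [Ioc_mem_nhdsGT (zero_lt_one (α := ℝ))] with t ht using h t ht.1 ht.2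

/-- Optimality conditions for `z ↦ 𝒟(z) + ‖z - u₀‖² / (2δ)`, with `𝒟` the support function
of `-K` and `D = 𝒟(u)`. -/
theorem optimality_of_minimizer [CompleteSpace H] {K : Set H} (hK : Convex ℝ K)
    (h0 : (0 : H) ∈ K) {u u0 : H} {δ D : ℝ} (hδ : 0 < δ) (hD : 0 ≤ D)
    (hKD : ∀ f ∈ K, -⟪u, f⟫ ≤ D)
    (hmin : ∀ (z : H) (c : ℝ), 0 ≤ c → (∀ f ∈ K, -⟪z, f⟫ ≤ c) →
      D + ‖u - u0‖ ^ 2 / (2 * δ) ≤ c + ‖z - u0‖ ^ 2 / (2 * δ)) :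
    δ⁻¹ • (u - u0) ∈ closure K ∧ D ≤ -⟪u, δ⁻¹ • (u - u0)⟫ := by
  have hexp : ∀ (z : H) (t : ℝ), ‖u + t • z - u0‖ ^ 2 / (2 * δ) =
      ‖u - u0‖ ^ 2 / (2 * δ) + t * ⟪z, δ⁻¹ • (u - u0)⟫ + t * (t * (‖z‖ ^ 2 / (2 * δ))) := by
    intro z t
    rw [show u + t • z - u0 = (u - u0) + t • z by abel, norm_add_sq_real, inner_smul_right,
      norm_smul, inner_smul_right, real_inner_comm, mul_pow, Real.norm_eq_abs, sq_abs]
    field_simp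
  constructor
  · by_contra hq
    obtain ⟨F, s, hFs, hsF⟩ := geometric_hahn_banach_closed_point hK.closure isClosed_closure hq
    set z := -(InnerProductSpace.toDual ℝ H).symm F with hz
    have hzF : ∀ f, -⟪z, f⟫ = F f := by
      intro f
      rw [hz, inner_neg_left, neg_neg, InnerProductSpace.toDual_symm_apply]
    have hs : 0 < s := by simpa using hFs 0 (subset_closure h0)
    have key : 0 ≤ s + ⟪z, δ⁻¹ • (u - u0)⟫ := by
      refine nonneg_of_forall_pos_le_one_add_mul (M := ‖z‖ ^ 2 / (2 * δ)) fun t ht _ => ?_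
      have := hmin (u + t • z) (D + t * s) (by positivity) fun f hf => by
        rw [inner_add_left, inner_smul_left, neg_add]
        have h1 := hKD f hf
        have h2 := mul_le_mul_of_nonneg_left (hFs f (subset_closure hf)).le ht.le
        rw [← hzF] at h2
        simp only [conj_trivial]
        linarith
      rw [hexp] at this
      refine nonneg_of_mul_nonneg_right (a := t) ?_ ht
      linarith
    have := hzF (δ⁻¹ • (u - u0))
    linarith
  · have key : 0 ≤ -⟪u, δ⁻¹ • (u - u0)⟫ - D := by
      refine nonneg_of_forall_pos_le_one_add_mul (M := ‖u‖ ^ 2 / (2 * δ)) fun t ht ht1 => ?_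
      have hc : 0 ≤ 1 - t := by linarith
      have := hmin (u + (-t) • u) ((1 - t) * D) (by positivity) fun f hf => by
        have h2 := mul_le_mul_of_nonneg_left (hKD f hf) hc
        rw [inner_add_left, inner_smul_left]
        simp only [conj_trivial]
        linarith
      rw [hexp] at this
      refine nonneg_of_mul_nonneg_right (a := t) ?_ ht
      linarith
    linarith

end Hilbert

section Gradient

variable {N : ℕ}

theorem continuous_gradient_of_contDiff {φ : EN N → ℝ} (hφ : ContDiff ℝ (⊤ : ℕ∞) φ) :
    Continuous (gradient φ) :=
  (InnerProductSpace.toDual ℝ (EN N)).symm.continuous.comp (hφ.continuous_fderiv (by simp))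

theorem hasCompactSupport_gradient {φ : EN N → ℝ} (hφ : HasCompactSupport φ) :
    HasCompactSupport (gradient φ) :=
  (hφ.fderiv (𝕜 := ℝ)).comp_left (g := (InnerProductSpace.toDual ℝ (EN N)).symm) (map_zero _)

theorem exists_Lp_eq_gradient (A : Set (EN N)) {φ : EN N → ℝ} (hφ : ContDiff ℝ (⊤ : ℕ∞) φ)
    (hc : HasCompactSupport φ) : ∃ f : L2 A, ⇑f =ᵐ[volume.restrict A] gradient φ := by
  have h : MemLp (gradient φ) 2 (volume.restrict A) :=
    (continuous_gradient_of_contDiff hφ).memLp_of_hasCompactSupport (hasCompactSupport_gradient hc)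
  exact ⟨h.toLp _, h.coeFn_toLp⟩

theorem inner_eq_setIntegral_gradient {A : Set (EN N)} (u : L2 A) {f : L2 A} {φ : EN N → ℝ}
    (hf : ⇑f =ᵐ[volume.restrict A] gradient φ) :
    ⟪u, f⟫ = ∫ x in A, ⟪u x, gradient φ x⟫ := by
  rw [L2.inner_def]
  exact integral_congr_ae (hf.mono fun x hx => by simp only [hx])

theorem DivEq.hasDivParts {A : Set (EN N)} {u : L2 A} {μ : SignedMeasure (EN N)}
    (h : DivEq A ⇑u μ) :
    HasDivParts A u μ.toJordanDecomposition.posPart μ.toJordanDecomposition.negPart :=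
  fun φ hφ hc hA _ hf => (inner_eq_setIntegral_gradient u hf).trans (h φ hφ hc hA)

theorem HasDivParts.neg {A : Set (EN N)} {u : L2 A} {a b : Measure (EN N)}
    (h : HasDivParts A u a b) : HasDivParts A (-u) b a := fun φ hφ hc hA f hf => by
  rw [inner_neg_left, h φ hφ hc hA f hf]
  ring

theorem gradient_neg_fun (v : EN N → ℝ) : gradient (-v) = -gradient v := by
  ext1 x
  simp [gradient, fderiv_neg]

theorem TestFn.neg {A : Set (EN N)} {v : EN N → ℝ} (hv : TestFn A v) : TestFn A (-v) := by
  obtain ⟨h1, h2, h3, h4⟩ := hv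
  refine ⟨h1.neg, ?_, ?_, fun x => by simpa using h4 x⟩
  · exact h2.comp_left (g := fun y : ℝ => -y) neg_zero
  · rwa [tsupport, Function.support_neg]

theorem testFn_zero (A : Set (EN N)) : TestFn A (0 : EN N → ℝ) :=
  ⟨contDiff_const, HasCompactSupport.zero, by simp [tsupport], by simp⟩

theorem zero_mem_testGradients (A : Set (EN N)) : (0 : L2 A) ∈ testGradients A :=
  ⟨0, testFn_zero A, by
    filter_upwards [Lp.coeFn_zero (EN N) 2 (volume.restrict A)] with x hx
    rw [hx]
    simp [gradient]⟩

theorem convex_testGradients (A : Set (EN N)) : Convex ℝ (testGradients A) := by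
  rintro f ⟨v, ⟨hv1, hv2, hv3, hv4⟩, hf⟩ g ⟨w, ⟨hw1, hw2, hw3, hw4⟩, hg⟩ s t hs ht hst
  refine ⟨s • v + t • w, ⟨(hv1.const_smul s).add (hw1.const_smul t), ?_, ?_, fun x => ?_⟩, ?_⟩
  · exact (hv2.smul_left (f := fun _ => s)).add (hw2.smul_left (f := fun _ => t))
  · refine (tsupport_add _ _).trans (union_subset ?_ ?_)
    · exact (tsupport_smul_subset_right (fun _ => s) v).trans hv3
    · exact (tsupport_smul_subset_right (fun _ => t) w).trans hw3
  · have h1 := abs_le.1 (hv4 x)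
    have h2 := abs_le.1 (hw4 x)
    simp only [Pi.add_apply, Pi.smul_apply, smul_eq_mul]
    rw [abs_le]
    constructor <;> nlinarith
  · filter_upwards [hf, hg, Lp.coeFn_add (s • f) (t • g), Lp.coeFn_smul s f, Lp.coeFn_smul t g]
      with x h1 h2 h3 h4 h5
    have hv := (hv1.differentiable (by simp)) x
    have hw := (hw1.differentiable (by simp)) x
    rw [h3, Pi.add_apply, h4, h5, Pi.smul_apply, Pi.smul_apply, h1, h2]
    simp only [gradient]
    rw [fderiv_add (hv.const_smul s) (hw.const_smul t), fderiv_const_smul hv,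
      fderiv_const_smul hw]
    simp

end Gradient

section Bump

variable {N : ℕ}

theorem exists_testFn_eq_one {K U : Set (EN N)} (hK : IsCompact K) (hU : IsOpen U)
    (hKU : K ⊆ U) : ∃ v : EN N → ℝ, TestFn U v ∧ (∀ x, 0 ≤ v x) ∧ ∀ x ∈ K, v x = 1 := by
  obtain ⟨L, hL, hKL, hLU⟩ := exists_compact_between hK hU hKU
  obtain ⟨f, hf0, hf1, hf⟩ := exists_contMDiffMap_zero_one_of_isClosed (n := ⊤)
    (modelWithCornersSelf ℝ (EN N)) (isOpen_interior (s := L)).isClosed_compl hK.isClosed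
    (disjoint_compl_left_iff_subset.2 hKL)
  have hsupp : tsupport f ⊆ L := by
    refine closure_minimal (fun x hx => ?_) hL.isClosed
    by_contra hxL
    exact hx (hf0 fun h => hxL (interior_subset h))
  refine ⟨f, ⟨f.contMDiff.contDiff, hL.of_isClosed_subset (isClosed_tsupport _) hsupp,
    hsupp.trans hLU, fun x => ?_⟩, fun x => (hf x).1, fun x hx => hf1 hx⟩
  rw [abs_of_nonneg (hf x).1]
  exact (hf x).2

theorem TestFn.eq_zero_of_notMem {U : Set (EN N)} {v : EN N → ℝ} (hv : TestFn U v) {x : EN N}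
    (hx : x ∉ U) : v x = 0 :=
  image_eq_zero_of_notMem_tsupport fun h => hx (hv.2.2.1 h)

theorem TestFn.integrable {U : Set (EN N)} {v : EN N → ℝ} (hv : TestFn U v)
    (a : Measure (EN N)) [IsFiniteMeasure a] : Integrable v a :=
  hv.1.continuous.integrable_of_hasCompactSupport hv.2.1

/-- A finite measure concentrated on an open set is determined from above by squares of
test functions. -/
theorem measure_le_of_forall_testFn_sq {A : Set (EN N)} (hA : IsOpen A) {a a0 : Measure (EN N)}
    [IsFiniteMeasure a] [IsFiniteMeasure a0] (haA : a Aᶜ = 0)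
    (h : ∀ v, TestFn A v → ∫ x, v x ^ 2 ∂a ≤ ∫ x, v x ^ 2 ∂a0) : a ≤ a0 := by
  refine Measure.le_iff.2 fun s hs => ?_
  have hsA : a s = a (s ∩ A) := (measure_inter_conull haA).symm
  rw [hsA, (hs.inter hA.measurableSet).measure_eq_iSup_isCompact_of_ne_top (measure_ne_top a _)]
  refine iSup₂_le fun K hKs => iSup_le fun hK => ?_
  refine le_trans ?_ (measure_mono (hKs.trans inter_subset_left))
  rw [K.measure_eq_iInf_isOpen a0]
  refine le_iInf₂ fun U hKU => le_iInf fun hU => ?_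
  obtain ⟨v, hv, hv0, hv1⟩ := exists_testFn_eq_one hK (hU.inter hA)
    (subset_inter hKU (hKs.trans inter_subset_right))
  have hvA : TestFn A v := ⟨hv.1, hv.2.1, hv.2.2.1.trans inter_subset_right, hv.2.2.2⟩
  have hint : ∀ (m : Measure (EN N)) [IsFiniteMeasure m], Integrable (fun x => v x ^ 2) m := by
    intro m _
    refine Integrable.of_bound (hv.1.continuous.pow 2).aestronglyMeasurable 1
      (Eventually.of_forall fun x => ?_)
    rw [norm_pow, Real.norm_eq_abs]
    exact pow_le_one₀ (abs_nonneg _) (hv.2.2.2 x)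
  have hK' : a.real K ≤ ∫ x, v x ^ 2 ∂a := by
    rw [← integral_indicator_one hK.measurableSet]
    refine integral_mono ((integrable_const _).indicator hK.measurableSet) (hint a) fun x => ?_
    by_cases hx : x ∈ K
    · simp [hx, hv1 x hx]
    · simp [hx, sq_nonneg]
  have hU' : ∫ x, v x ^ 2 ∂a0 ≤ a0.real U := by
    rw [← integral_indicator_one hU.measurableSet]
    refine integral_mono (hint a0) ((integrable_const _).indicator hU.measurableSet) fun x => ?_
    by_cases hx : x ∈ U
    · simpa [hx] using hv.2.2.2 x
    · simp [hx, hv.eq_zero_of_notMem fun h => hx h.1]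
  have := (hK'.trans (h v hvA)).trans hU'
  exact (ENNReal.toReal_le_toReal (measure_ne_top _ _) (measure_ne_top _ _)).1 this

/-- Test functions approximate the sign of `a - b` for mutually singular `a`, `b`. -/
theorem exists_testFn_integral_ge {A : Set (EN N)} (hA : IsOpen A) {a b : Measure (EN N)}
    [IsFiniteMeasure a] [IsFiniteMeasure b] (hab : a ⟂ₘ b) (haA : a Aᶜ = 0) (hbA : b Aᶜ = 0)
    {η : ℝ} (hη : 0 < η) :
    ∃ v, TestFn A v ∧ a.real univ + b.real univ - η ≤ (∫ x, v x ∂a) - ∫ x, v x ∂b := by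
  obtain ⟨S, hS, haS, hbS⟩ := hab
  have key : ∀ (m : Measure (EN N)) [IsFiniteMeasure m] (T : Set (EN N)), MeasurableSet T →
      m Tᶜ = 0 → m Aᶜ = 0 → ∃ K ⊆ T ∩ A, IsCompact K ∧ m.real Kᶜ ≤ η / 4 := by
    intro m _ T hT hmT hmA
    have hTA : MeasurableSet (T ∩ A) := hT.inter hA.measurableSet
    obtain ⟨K, hKs, hK, hlt⟩ := hTA.exists_isCompact_lt_add (μ := m) (measure_ne_top _ _)
      (ε := ENNReal.ofReal (η / 4)) (by simpa using hη)
    refine ⟨K, hKs, hK, ?_⟩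
    have h1 : m (T ∩ A) = m univ := by
      rw [measure_inter_conull hmA, ← univ_inter T, measure_inter_conull hmT]
    rw [h1] at hlt
    rw [measureReal_compl hK.measurableSet]
    have h2 := (ENNReal.toReal_le_toReal (by finiteness) (by finiteness)).2 hlt.le
    rw [ENNReal.toReal_add (by finiteness) (by finiteness), ENNReal.toReal_ofReal (by positivity)]
      at h2
    simp only [Measure.real]
    linarith
  obtain ⟨K, hKs, hK, hKa⟩ := key a Sᶜ hS.compl (by rwa [compl_compl]) haA
  obtain ⟨L, hLs, hL, hLb⟩ := key b S hS hbS hbA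
  have hKL : Disjoint K L := disjoint_left.2 fun x hx hx' => (hKs hx).1 (hLs hx').1
  obtain ⟨v, hv, hv0, hv1⟩ := exists_testFn_eq_one hK (hA.sdiff hL.isClosed)
    (subset_sdiff.2 ⟨hKs.trans inter_subset_right, hKL⟩)
  obtain ⟨w, hw, hw0, hw1⟩ := exists_testFn_eq_one hL (hA.sdiff hK.isClosed)
    (subset_sdiff.2 ⟨hLs.trans inter_subset_right, hKL.symm⟩)
  have hvw : TestFn A (v - w) := by
    refine ⟨hv.1.sub hw.1, ?_, ?_, fun x => ?_⟩
    · exact hv.2.1.sub hw.2.1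
    · refine (tsupport_sub _ _).trans (union_subset ?_ ?_)
      · exact hv.2.2.1.trans sdiff_subset
      · exact hw.2.2.1.trans sdiff_subset
    · have h1 := abs_le.1 (hv.2.2.2 x)
      have h2 := abs_le.1 (hw.2.2.2 x)
      rw [Pi.sub_apply, abs_le]
      constructor <;> linarith [hv0 x, hw0 x]
  have hest : ∀ (m : Measure (EN N)) [IsFiniteMeasure m] (C : Set (EN N)) (z : EN N → ℝ),
      IsCompact C → TestFn A z → (∀ x ∈ C, z x = 1) → m.real Cᶜ ≤ η / 4 →
      m.real univ - η / 2 ≤ ∫ x, z x ∂m := by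
    intro m _ C z hC hz hzC hm
    have hint : Integrable (Cᶜ.indicator fun _ => (2 : ℝ)) m :=
      (integrable_const _).indicator hC.measurableSet.compl
    have h1 : ∫ x, (1 - Cᶜ.indicator (fun _ => (2 : ℝ)) x) ∂m ≤ ∫ x, z x ∂m := by
      refine integral_mono ((integrable_const _).sub hint) (hz.integrable m) fun x => ?_
      by_cases hx : x ∈ C
      · simp [hx, hzC x hx]
      · have := abs_le.1 (hz.2.2.2 x)
        simp only [mem_compl_iff, hx, not_false_eq_true, indicator_of_mem]
        linarith
    rw [integral_sub (integrable_const _) hint, integral_indicator hC.measurableSet.compl] at h1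
    simp only [integral_const, smul_eq_mul, measureReal_restrict_apply_univ, mul_one] at h1
    linarith
  have h1 := hest a K (v - w) hK hvw (fun x hx => by
    rw [Pi.sub_apply, hv1 x hx, hw.eq_zero_of_notMem (fun h => h.2 hx), sub_zero]) hKa
  have h2 := hest b L (-(v - w)) hL hvw.neg (fun x hx => by
    rw [Pi.neg_apply, Pi.sub_apply, hw1 x hx, hv.eq_zero_of_notMem (fun h => h.2 hx)]
    ring) hLb
  simp only [Pi.neg_apply, integral_neg] at h2
  exact ⟨v - w, hvw, by linarith⟩

end Bump

section Estimate

variable {N : ℕ}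

theorem gradient_sq_mul_pow {ψ v : EN N → ℝ} {x : EN N} (hψ : DifferentiableAt ℝ ψ x)
    (hv : DifferentiableAt ℝ v x) (m : ℕ) :
    gradient (fun y => ψ y ^ 2 * ((1 + v y) / 2) ^ (m + 1)) x =
      (2 * ψ x * ((1 + v x) / 2) ^ (m + 1)) • gradient ψ x +
        (ψ x ^ 2 * (((m : ℝ) + 1) / 2 * ((1 + v x) / 2) ^ m)) • gradient v x := by
  have ht : HasFDerivAt (fun y => (1 + v y) / 2) ((2⁻¹ : ℝ) • fderiv ℝ v x) x := by
    simpa [div_eq_inv_mul] using (hv.hasFDerivAt.const_add 1).const_mul (2⁻¹ : ℝ)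
  have h := (hψ.hasFDerivAt.pow 2).mul (ht.pow (m + 1))
  have h' : fderiv ℝ (fun y => ψ y ^ 2 * ((1 + v y) / 2) ^ (m + 1)) x = _ := h.fderiv
  simp only [gradient]
  rw [h', map_add, add_comm]
  simp only [map_smul, smul_smul]
  congr 2
  · simp only [nsmul_eq_mul, Nat.add_one_sub_one, pow_one]
    push_cast
    ring
  · simp only [nsmul_eq_mul, Nat.add_one_sub_one]
    push_cast
    ring

theorem norm_smul_add_smul_sq_le {E : Type*} [NormedAddCommGroup E] [InnerProductSpace ℝ E]
    (G F : E) {α β p q : ℝ} (hα : α ^ 2 ≤ p) (hβ : β ^ 2 ≤ q) :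
    ⟪α • G + β • F, α • G + β • F⟫ ≤ 2 * p * ⟪G, G⟫ + 2 * q * ⟪F, F⟫ := by
  have h1 : ‖α • G + β • F‖ ^ 2 ≤ 2 * ‖α • G‖ ^ 2 + 2 * ‖β • F‖ ^ 2 := by
    have := parallelogram_law_with_norm ℝ (α • G) (β • F)
    nlinarith [sq_nonneg ‖α • G - β • F‖]
  simp only [norm_smul, mul_pow, Real.norm_eq_abs, sq_abs] at h1
  simp only [real_inner_self_eq_norm_sq]
  nlinarith [mul_le_mul_of_nonneg_right hα (sq_nonneg ‖G‖),
    mul_le_mul_of_nonneg_right hβ (sq_nonneg ‖F‖)]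

theorem inner_smul_add_smul_ge {E : Type*} [NormedAddCommGroup E] [InnerProductSpace ℝ E]
    (G F : E) {s t c : ℝ} (m : ℕ) (ht : 0 ≤ t) (ht1 : t ≤ 1) (hc : 0 < c) :
    -(2 / c * ⟪G, G⟫) ≤
      ⟪F, (2 * s * t ^ (m + 1)) • G + (s ^ 2 * (c / 2 * t ^ m)) • F⟫ := by
  have hsq : 0 ≤ t ^ m * (2 / c) * ⟪t • G + (c / 2 * s) • F, t • G + (c / 2 * s) • F⟫ :=
    mul_nonneg (by positivity) real_inner_self_nonneg
  have hexp : t ^ m * (2 / c) * ⟪t • G + (c / 2 * s) • F, t • G + (c / 2 * s) • F⟫ =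
      2 / c * t ^ (m + 2) * ⟪G, G⟫ +
        ⟪F, (2 * s * t ^ (m + 1)) • G + (s ^ 2 * (c / 2 * t ^ m)) • F⟫ := by
    simp only [inner_add_left, inner_add_right, inner_smul_left, inner_smul_right, conj_trivial,
      real_inner_comm F G]
    field_simp
    ring
  have hle : 2 / c * t ^ (m + 2) * ⟪G, G⟫ ≤ 2 / c * ⟪G, G⟫ := by
    refine mul_le_mul_of_nonneg_right ?_ real_inner_self_nonneg
    exact mul_le_of_le_one_right (by positivity) (pow_le_one₀ ht ht1)
  linarith

theorem integral_sq_le_of_almost_calibrated {A : Set (EN N)} {δ : ℝ} (hδ : 0 < δ) {u u0 : L2 A}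
    {a b a0 b0 : Measure (EN N)} [IsFiniteMeasure a] [IsFiniteMeasure b] [IsFiniteMeasure a0]
    [IsFiniteMeasure b0] (hu : HasDivParts A u a b) (hu0 : HasDivParts A u0 a0 b0)
    {v ψ : EN N → ℝ} (hv : TestFn A v) (hψ : TestFn A ψ) {f g : L2 A}
    (hf : ⇑f =ᵐ[volume.restrict A] gradient v) (hg : ⇑g =ᵐ[volume.restrict A] gradient ψ)
    (m : ℕ) :
    ∫ x, ψ x ^ 2 ∂a ≤ ∫ x, ψ x ^ 2 ∂a0
      + (m + 1) * ((∫ x, (1 - v x) ∂a) + ∫ x, (1 + v x) ∂b)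
      + δ * (2 / (m + 1) * ‖g‖ ^ 2)
      + ‖u - u0 - δ • f‖ * √(8 * ‖g‖ ^ 2 + (m + 1) ^ 2 / 2 * ‖f‖ ^ 2) := by
  set c : ℝ := (m : ℝ) + 1 with hc
  have hc1 : 1 ≤ c := by simp [hc]
  set t : EN N → ℝ := fun x => (1 + v x) / 2 with ht
  set Φ : EN N → ℝ := fun x => ψ x ^ 2 * ((1 + v x) / 2) ^ (m + 1) with hΦ
  have ht0 : ∀ x, 0 ≤ t x := fun x => by
    have := (abs_le.1 (hv.2.2.2 x)).1
    simp only [ht]; linarith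
  have ht1 : ∀ x, t x ≤ 1 := fun x => by
    have := (abs_le.1 (hv.2.2.2 x)).2
    simp only [ht]; linarith
  have hψ1 : ∀ x, ψ x ^ 2 ≤ 1 := fun x => (sq_le_one_iff_abs_le_one _).2 (hψ.2.2.2 x)
  have hΦs : ContDiff ℝ (⊤ : ℕ∞) Φ :=
    (hψ.1.pow 2).mul (((contDiff_const.add hv.1).div_const 2).pow (m + 1))
  have hΦsupp : tsupport Φ ⊆ tsupport ψ := closure_mono fun x hx => by
    contrapose! hx
    simp only [Function.mem_support, not_not] at hx ⊢
    simp [hΦ, hx]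
  have hΦc : HasCompactSupport Φ := hψ.2.1.of_isClosed_subset (isClosed_tsupport _) hΦsupp
  have hΦA : tsupport Φ ⊆ A := hΦsupp.trans hψ.2.2.1
  obtain ⟨h, hh⟩ := exists_Lp_eq_gradient A hΦs hΦc
  have hgrad : ∀ᵐ x ∂volume.restrict A, h x = (2 * ψ x * t x ^ (m + 1)) • g x +
      (ψ x ^ 2 * (c / 2 * t x ^ m)) • f x := by
    filter_upwards [hh, hf, hg] with x h1 h2 h3
    rw [h1, h2, h3]
    exact gradient_sq_mul_pow (hψ.1.differentiable (by simp) x) (hv.1.differentiable (by simp) x) m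
  have hnorm : ‖h‖ ≤ √(8 * ‖g‖ ^ 2 + c ^ 2 / 2 * ‖f‖ ^ 2) := by
    refine Real.le_sqrt_of_sq_le ?_
    simp only [← real_inner_self_eq_norm_sq, L2.inner_def]
    rw [← integral_const_mul, ← integral_const_mul,
      ← integral_add ((L2.integrable_inner g g).const_mul _)
        ((L2.integrable_inner f f).const_mul _)]
    refine integral_mono_ae (L2.integrable_inner h h)
      (((L2.integrable_inner g g).const_mul _).add ((L2.integrable_inner f f).const_mul _)) ?_
    filter_upwards [hgrad] with x hx
    simp only [hx]
    refine (norm_smul_add_smul_sq_le (p := 4) (q := c ^ 2 / 4) _ _ ?_ ?_).trans (le_of_eq (by ring))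
    · have h1 : (t x ^ (m + 1)) ^ 2 ≤ 1 :=
        pow_le_one₀ (pow_nonneg (ht0 x) _) (pow_le_one₀ (ht0 x) (ht1 x))
      have h2 := mul_le_one₀ (hψ1 x) (sq_nonneg _) h1
      linarith [show (2 * ψ x * t x ^ (m + 1)) ^ 2 = 4 * (ψ x ^ 2 * (t x ^ (m + 1)) ^ 2) by ring]
    · have h1 : (t x ^ m) ^ 2 ≤ 1 :=
        pow_le_one₀ (pow_nonneg (ht0 x) _) (pow_le_one₀ (ht0 x) (ht1 x))
      have h2 := mul_le_one₀ (pow_le_one₀ (n := 2) (sq_nonneg _) (hψ1 x)) (sq_nonneg _) h1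
      have h3 := mul_le_mul_of_nonneg_left h2 (show 0 ≤ c ^ 2 / 4 by positivity)
      linarith [show (ψ x ^ 2 * (c / 2 * t x ^ m)) ^ 2 =
        c ^ 2 / 4 * ((ψ x ^ 2) ^ 2 * (t x ^ m) ^ 2) by ring]
  have hinner : -(2 / c * ‖g‖ ^ 2) ≤ ⟪f, h⟫ := by
    simp only [← real_inner_self_eq_norm_sq, L2.inner_def]
    rw [← integral_const_mul, ← integral_neg]
    refine integral_mono_ae ((L2.integrable_inner g g).const_mul _).neg
      (L2.integrable_inner f h) ?_
    filter_upwards [hgrad] with x hx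
    simp only [hx]
    exact inner_smul_add_smul_ge _ _ m (ht0 x) (ht1 x) (by positivity)
  have hcs : -(‖u - u0 - δ • f‖ * √(8 * ‖g‖ ^ 2 + c ^ 2 / 2 * ‖f‖ ^ 2)) ≤
      ⟪u - u0 - δ • f, h⟫ := by
    have h1 := (abs_le.1 (abs_real_inner_le_norm (u - u0 - δ • f) h)).1
    have h2 := mul_le_mul_of_nonneg_left hnorm (norm_nonneg (u - u0 - δ • f))
    linarith
  have hsplit : ⟪u - u0 - δ • f, h⟫ = ⟪u, h⟫ - ⟪u0, h⟫ - δ * ⟪f, h⟫ := by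
    simp [inner_sub_left, inner_smul_left]
  rw [hu Φ hΦs hΦc hΦA h hh, hu0 Φ hΦs hΦc hΦA h hh] at hsplit
  have hδinner := mul_le_mul_of_nonneg_left hinner hδ.le
  have hψint : ∀ (n : Measure (EN N)) [IsFiniteMeasure n], Integrable (fun x => ψ x ^ 2) n :=
    fun n _ => Integrable.of_bound (hψ.1.continuous.pow 2).aestronglyMeasurable 1
      (Eventually.of_forall fun x => by
        rw [Real.norm_eq_abs, abs_of_nonneg (sq_nonneg _)]
        exact hψ1 x)
  have hΦint : ∀ (n : Measure (EN N)) [IsFiniteMeasure n], Integrable Φ n := fun n _ =>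
    hΦs.continuous.integrable_of_hasCompactSupport hΦc
  have hΦ0 : ∀ x, 0 ≤ Φ x := fun x => mul_nonneg (sq_nonneg _) (pow_nonneg (ht0 x) _)
  have hA0 : ∫ x, Φ x ∂a0 ≤ ∫ x, ψ x ^ 2 ∂a0 :=
    integral_mono (hΦint a0) (hψint a0) fun x =>
      mul_le_of_le_one_right (sq_nonneg _) (pow_le_one₀ (ht0 x) (ht1 x))
  have hB0 : 0 ≤ ∫ x, Φ x ∂b0 := integral_nonneg hΦ0
  have hvi : Integrable (fun x => 1 - v x) a := (integrable_const _).sub (hv.integrable a)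
  have hvi' : Integrable (fun x => 1 + v x) b := (integrable_const _).add (hv.integrable b)
  have hAa : (∫ x, ψ x ^ 2 ∂a) - c * ∫ x, (1 - v x) ∂a ≤ ∫ x, Φ x ∂a := by
    rw [← integral_const_mul, ← integral_sub (hψint a) (hvi.const_mul c)]
    refine integral_mono ((hψint a).sub (hvi.const_mul c)) (hΦint a) fun x => ?_
    have hb := one_add_mul_le_pow (a := t x - 1) (by linarith [ht0 x]) (m + 1)
    rw [add_sub_cancel] at hb
    push_cast at hb
    have h1 := mul_le_mul_of_nonneg_left hb (sq_nonneg (ψ x))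
    have h2 : ψ x ^ 2 * (c * (1 - t x)) ≤ c * (1 - t x) :=
      mul_le_of_le_one_left (mul_nonneg (by positivity) (by linarith [ht1 x])) (hψ1 x)
    have h3 : c * (1 - t x) ≤ c * (1 - v x) := by
      refine mul_le_mul_of_nonneg_left ?_ (by positivity)
      have := (abs_le.1 (hv.2.2.2 x)).2
      simp only [ht]; linarith
    have h4 : Φ x = ψ x ^ 2 * t x ^ (m + 1) := rfl
    simp only [h4]
    linarith
  have hBb : ∫ x, Φ x ∂b ≤ c * ∫ x, (1 + v x) ∂b := by
    rw [← integral_const_mul]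
    refine integral_mono (hΦint b) (hvi'.const_mul c) fun x => ?_
    have h1 : Φ x ≤ t x ^ (m + 1) := mul_le_of_le_one_left (pow_nonneg (ht0 x) _) (hψ1 x)
    have h2 : t x ^ (m + 1) ≤ t x := pow_le_of_le_one (ht0 x) (ht1 x) (by simp)
    have h3 : 0 ≤ 1 + v x := by linarith [(abs_le.1 (hv.2.2.2 x)).1]
    have h4 : t x ≤ 1 + v x := by simp only [ht]; linarith
    exact (h1.trans h2).trans (h4.trans (le_mul_of_one_le_left h3 hc1))
  linarith

theorem integral_sq_le_of_forall_almost_calibrated {A : Set (EN N)} {δ : ℝ} (hδ : 0 < δ)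
    {u u0 : L2 A} {a b a0 b0 : Measure (EN N)} [IsFiniteMeasure a] [IsFiniteMeasure b]
    [IsFiniteMeasure a0] [IsFiniteMeasure b0] (hu : HasDivParts A u a b)
    (hu0 : HasDivParts A u0 a0 b0)
    (hcal : ∀ η : ℝ, 0 < η → ∃ v, TestFn A v ∧ ∃ f : L2 A,
      ⇑f =ᵐ[volume.restrict A] gradient v ∧ ‖u - u0 - δ • f‖ ≤ η ∧
        (∫ x, (1 - v x) ∂a) + ∫ x, (1 + v x) ∂b ≤ η)
    {ψ : EN N → ℝ} (hψ : TestFn A ψ) : ∫ x, ψ x ^ 2 ∂a ≤ ∫ x, ψ x ^ 2 ∂a0 := by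
  obtain ⟨g, hg⟩ := exists_Lp_eq_gradient A hψ.1 hψ.2.1
  have hm : ∀ m : ℕ, ∫ x, ψ x ^ 2 ∂a ≤
      ∫ x, ψ x ^ 2 ∂a0 + δ * 2 * ‖g‖ ^ 2 * (1 / ((m : ℝ) + 1)) := by
    intro m
    set R : ℝ := (‖u - u0‖ + 1) / δ with hR
    set M : ℝ := √(8 * ‖g‖ ^ 2 + ((m : ℝ) + 1) ^ 2 / 2 * R ^ 2) with hM
    suffices 0 ≤ ∫ x, ψ x ^ 2 ∂a0 + δ * (2 / (m + 1) * ‖g‖ ^ 2) - ∫ x, ψ x ^ 2 ∂a by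
      rw [show δ * 2 * ‖g‖ ^ 2 * (1 / ((m : ℝ) + 1)) = δ * (2 / (m + 1) * ‖g‖ ^ 2) by
        field_simp]
      linarith
    refine nonneg_of_forall_pos_le_one_add_mul (M := (m + 1) + M) fun η hη hη1 => ?_
    obtain ⟨v, hv, f, hf, hfη, hvη⟩ := hcal η hη
    have hest := integral_sq_le_of_almost_calibrated hδ hu hu0 hv hψ hf hg m
    have hfR : ‖f‖ ≤ R := by
      rw [hR, le_div_iff₀ hδ]
      have h1 : ‖δ • f‖ ≤ ‖u - u0‖ + ‖u - u0 - δ • f‖ := by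
        rw [show δ • f = (u - u0) - (u - u0 - δ • f) by abel]
        refine (norm_sub_le _ _).trans (le_of_eq ?_)
        rw [sub_sub_cancel]
      rw [norm_smul, Real.norm_of_nonneg hδ.le] at h1
      linarith
    have hsqrt : √(8 * ‖g‖ ^ 2 + ((m : ℝ) + 1) ^ 2 / 2 * ‖f‖ ^ 2) ≤ M := by
      refine Real.sqrt_le_sqrt ?_
      gcongr
    have h1 := mul_le_mul hfη hsqrt (Real.sqrt_nonneg _) hη.le
    have h2 := mul_le_mul_of_nonneg_left hvη (show (0 : ℝ) ≤ (m : ℝ) + 1 by positivity)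
    linarith
  have hlim : Tendsto (fun m : ℕ => ∫ x, ψ x ^ 2 ∂a0 + δ * 2 * ‖g‖ ^ 2 * (1 / ((m : ℝ) + 1)))
      atTop (𝓝 (∫ x, ψ x ^ 2 ∂a0)) := by
    simpa using (tendsto_one_div_add_atTop_nhds_zero_nat.const_mul (δ * 2 * ‖g‖ ^ 2)).const_add
      (∫ x, ψ x ^ 2 ∂a0)
  exact ge_of_tendsto' hlim hm

/-- A minimizer admits test functions that almost calibrate it and whose gradients
approximate `(u - u₀) / δ`. -/
theorem exists_almost_calibrated {A : Set (EN N)} (hA : IsOpen A) {δ : ℝ} (hδ : 0 < δ)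
    {u u0 : L2 A} {a b : Measure (EN N)} [IsFiniteMeasure a] [IsFiniteMeasure b]
    (hab : a ⟂ₘ b) (haA : a Aᶜ = 0) (hbA : b Aᶜ = 0) (hu : HasDivParts A u a b)
    (hmin : ∀ z : L2 A,
      divTV A ⇑u + ENNReal.ofReal (‖u - u0‖ ^ 2 / (2 * δ)) ≤
        divTV A ⇑z + ENNReal.ofReal (‖z - u0‖ ^ 2 / (2 * δ)))
    {η : ℝ} (hη : 0 < η) :
    ∃ v, TestFn A v ∧ ∃ f : L2 A,
      ⇑f =ᵐ[volume.restrict A] gradient v ∧ ‖u - u0 - δ • f‖ ≤ η ∧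
        (∫ x, (1 - v x) ∂a) + ∫ x, (1 + v x) ∂b ≤ η := by
  set D : ℝ := a.real univ + b.real univ with hD
  have hD0 : 0 ≤ D := by positivity
  have hpair : ∀ (v : EN N → ℝ), TestFn A v → ∀ f : L2 A,
      ⇑f =ᵐ[volume.restrict A] gradient v → -⟪u, f⟫ = (∫ x, v x ∂a) - ∫ x, v x ∂b :=
    fun v hv f hf => by rw [hu v hv.1 hv.2.1 hv.2.2.1 f hf, neg_neg]
  have hdefect : ∀ v : EN N → ℝ, TestFn A v → (∫ x, (1 - v x) ∂a) + ∫ x, (1 + v x) ∂b =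
      D - ((∫ x, v x ∂a) - ∫ x, v x ∂b) := by
    intro v hv
    rw [integral_sub (integrable_const _) (hv.integrable a),
      integral_add (integrable_const _) (hv.integrable b)]
    simp only [integral_const, smul_eq_mul, mul_one, hD]
    ring
  have hle : ∀ f ∈ testGradients A, -⟪u, f⟫ ≤ D := by
    rintro f ⟨v, hv, hf⟩
    have h1 : 0 ≤ ∫ x, (1 - v x) ∂a :=
      integral_nonneg fun x => by simpa using (abs_le.1 (hv.2.2.2 x)).2
    have h2 : 0 ≤ ∫ x, (1 + v x) ∂b :=
      integral_nonneg fun x => by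
        have := (abs_le.1 (hv.2.2.2 x)).1
        simp only [Pi.zero_apply]; linarith
    linarith [hpair v hv f hf, hdefect v hv]
  have hTVle : ∀ (z : L2 A) (c : ℝ), (∀ f ∈ testGradients A, -⟪z, f⟫ ≤ c) →
      divTV A ⇑z ≤ ENNReal.ofReal c := by
    refine fun z c hz => iSup_le fun v => ENNReal.ofReal_le_ofReal ?_
    obtain ⟨f, hf⟩ := exists_Lp_eq_gradient A v.2.1 v.2.2.1
    rw [← inner_eq_setIntegral_gradient z hf]
    exact hz f ⟨v, v.2, hf⟩
  have hTVge : ENNReal.ofReal D ≤ divTV A ⇑u := by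
    refine ENNReal.le_of_forall_pos_le_add fun ε hε _ => ?_
    obtain ⟨v, hv, hge⟩ := exists_testFn_integral_ge hA hab haA hbA (η := ε) (by exact_mod_cast hε)
    obtain ⟨f, hf⟩ := exists_Lp_eq_gradient A hv.1 hv.2.1
    have h1 : ENNReal.ofReal (-⟪u, f⟫) ≤ divTV A ⇑u := by
      rw [inner_eq_setIntegral_gradient u hf]
      exact le_iSup (fun v : {v : EN N → ℝ // TestFn A v} =>
        ENNReal.ofReal (-∫ x in A, ⟪u x, gradient (v : EN N → ℝ) x⟫)) ⟨v, hv⟩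
    calc ENNReal.ofReal D ≤ ENNReal.ofReal (-⟪u, f⟫ + ε) :=
          ENNReal.ofReal_le_ofReal (by linarith [hpair v hv f hf])
      _ ≤ ENNReal.ofReal (-⟪u, f⟫) + ENNReal.ofReal ε := ENNReal.ofReal_add_le
      _ ≤ divTV A ⇑u + ε := by
          rw [ENNReal.ofReal_coe_nnreal]
          gcongr
  obtain ⟨hq, hDq⟩ := optimality_of_minimizer (convex_testGradients A) (zero_mem_testGradients A)
    (u := u) (u0 := u0) hδ hD0 hle fun z c hc hz => by
      have h1 := ((add_le_add_left hTVge _).trans (hmin z)).trans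
        (add_le_add_left (hTVle z c hz) _)
      rw [← ENNReal.ofReal_add hD0 (by positivity), ← ENNReal.ofReal_add hc (by positivity)] at h1
      exact (ENNReal.ofReal_le_ofReal_iff (by positivity)).1 h1
  have hε : 0 < η / (δ + ‖u‖) := by positivity
  obtain ⟨f, ⟨v, hv, hf⟩, hdist⟩ := Metric.mem_closure_iff.1 hq _ hε
  rw [dist_eq_norm] at hdist
  have hbound : ‖δ⁻¹ • (u - u0) - f‖ * (δ + ‖u‖) ≤ η :=
    ((lt_div_iff₀ (by positivity)).1 hdist).le
  have hn := norm_nonneg (δ⁻¹ • (u - u0) - f)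
  refine ⟨v, hv, f, hf, ?_, ?_⟩
  · rw [show u - u0 - δ • f = δ • (δ⁻¹ • (u - u0) - f) by
      rw [smul_sub, smul_inv_smul₀ hδ.ne'], norm_smul, Real.norm_of_nonneg hδ.le]
    nlinarith [mul_nonneg hn (norm_nonneg u)]
  · rw [hdefect v hv, ← hpair v hv f hf]
    have h1 := (abs_le.1 (abs_real_inner_le_norm u (δ⁻¹ • (u - u0) - f))).1
    rw [inner_sub_right] at h1
    nlinarith [mul_nonneg hn hδ.le]

end Estimate

/-- if `u` minimizes `z ↦ 𝒟(z) + ‖z-u0‖²/(2δ)` and `div u = μ`,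
`div u0 = μ0`, then `μ ≪ μ0`, `μ⁺ ≤ μ0⁺` and `μ⁻ ≤ μ0⁻`. -/
theorem stmt_10 {N : ℕ} (hN : 1 ≤ N) (A : Set (EN N)) (hA : IsOpen A)
    (δ : ℝ) (hδ : 0 < δ) (u0 u : L2 A) (μ0 μ : SignedMeasure (EN N))
    (hμ0A : μ0.totalVariation Aᶜ = 0) (hμA : μ.totalVariation Aᶜ = 0)
    (hdiv0 : DivEq A ⇑u0 μ0) (hdiv : DivEq A ⇑u μ)
    (hmin : ∀ z : L2 A,
      divTV A ⇑u + ENNReal.ofReal (‖u - u0‖ ^ 2 / (2 * δ)) ≤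
        divTV A ⇑z + ENNReal.ofReal (‖z - u0‖ ^ 2 / (2 * δ))) :
    μ.totalVariation ≪ μ0.totalVariation ∧
    μ.toJordanDecomposition.posPart ≤ μ0.toJordanDecomposition.posPart ∧
    μ.toJordanDecomposition.negPart ≤ μ0.toJordanDecomposition.negPart := by

  set a := μ.toJordanDecomposition.posPart with ha
  set b := μ.toJordanDecomposition.negPart with hb
  set a0 := μ0.toJordanDecomposition.posPart with ha0
  set b0 := μ0.toJordanDecomposition.negPart with hb0
  have htv : μ.totalVariation = a + b := rfl
  have htv0 : μ0.totalVariation = a0 + b0 := rfl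
  have hA' : a Aᶜ = 0 ∧ b Aᶜ = 0 := by simpa [htv] using hμA
  have hu : HasDivParts A u a b := hdiv.hasDivParts
  have hu0 : HasDivParts A u0 a0 b0 := hdiv0.hasDivParts
  have hcal := fun η (hη : (0 : ℝ) < η) => exists_almost_calibrated hA hδ
    μ.toJordanDecomposition.mutuallySingular hA'.1 hA'.2 hu hmin hη
  have hpos : a ≤ a0 := measure_le_of_forall_testFn_sq hA hA'.1 fun ψ hψ =>
    integral_sq_le_of_forall_almost_calibrated hδ hu hu0 hcal hψ
  have hneg : b ≤ b0 := measure_le_of_forall_testFn_sq hA hA'.2 fun ψ hψ => by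
    refine integral_sq_le_of_forall_almost_calibrated hδ hu.neg hu0.neg (fun η hη => ?_) hψ
    obtain ⟨v, hv, f, hf, hfη, hvη⟩ := hcal η hη
    refine ⟨-v, hv.neg, -f, ?_, ?_, ?_⟩
    · filter_upwards [hf, Lp.coeFn_neg f] with x h1 h2
      rw [h2, gradient_neg_fun, Pi.neg_apply, Pi.neg_apply, h1]
    · rwa [show -u - -u0 - δ • -f = -(u - u0 - δ • f) by rw [smul_neg]; abel, norm_neg]
    · simp only [Pi.neg_apply, sub_neg_eq_add, ← sub_eq_add_neg]
      rwa [add_comm]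
  refine ⟨?_, hpos, hneg⟩
  rw [htv, htv0]
  exact (add_le_add hpos hneg).absolutelyContinuous
end
end

section
/- Let N ≥ 1, let A ⊆ ℝ^N be open, let u0 ∈ L²(A;ℝ^N), and let u be a solution of the gradient flow of 𝒟 starting from u0. Let 0 ≤ s < t and suppose div u(s) = μ_s and div u(t) = μ_t for finite signed Borel measures μ_s, μ_t on A. Then, for the Jordan decompositions, μ_t^+ ≤ μ_s^+ and μ_t^- ≤ μ_s^-. -/
open MeasureTheory Topology Filter Metric Set
open scoped ENNReal RealInnerProductSpace

noncomputable section

/-- The space of smooth functions with compact support contained in `A`. -/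
def testSpace {N : ℕ} (A : Set (EN N)) : Submodule ℝ (EN N → ℝ) where
  carrier := {φ | ContDiff ℝ (⊤ : ℕ∞) φ ∧ HasCompactSupport φ ∧ tsupport φ ⊆ A}
  zero_mem' := ⟨contDiff_const, HasCompactSupport.zero, by simp [tsupport]⟩
  add_mem' := fun {f g} hf hg =>
    ⟨hf.1.add hg.1, hf.2.1.add hg.2.1,
      (tsupport_add f g).trans (union_subset hf.2.2 hg.2.2)⟩
  smul_mem' := fun c f hf =>
    ⟨contDiff_const.smul hf.1, hf.2.1.smul_left (f := fun _ => c),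
      (tsupport_smul_subset_right (fun _ => c) f).trans hf.2.2⟩

section TestSpace

variable {N : ℕ} {A : Set (EN N)}

lemma gradient_add_of_differentiableAt {f g : EN N → ℝ} {x : EN N}
    (hf : DifferentiableAt ℝ f x) (hg : DifferentiableAt ℝ g x) :
    gradient (f + g) x = gradient f x + gradient g x := by
  simp only [gradient, fderiv_add hf hg, map_add]

lemma gradient_mul_of_differentiableAt {f g : EN N → ℝ} {x : EN N}
    (hf : DifferentiableAt ℝ f x) (hg : DifferentiableAt ℝ g x) :
    gradient (f * g) x = f x • gradient g x + g x • gradient f x := by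
  simp only [gradient, fderiv_mul hf hg, map_add, map_smulₛₗ, conj_trivial]

lemma gradient_comp_of_hasDerivAt {h : ℝ → ℝ} {h' : ℝ} {f : EN N → ℝ} {x : EN N}
    (hh : HasDerivAt h h' (f x)) (hf : DifferentiableAt ℝ f x) :
    gradient (h ∘ f) x = h' • gradient f x := by
  simp only [gradient, (hh.comp_hasFDerivAt x hf.hasFDerivAt).fderiv, map_smulₛₗ, conj_trivial]

lemma testSpace_differentiable {φ : EN N → ℝ} (hφ : φ ∈ testSpace A) : Differentiable ℝ φ :=
  hφ.1.differentiable (by simp)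

lemma comp_mem_testSpace {h : ℝ → ℝ} {φ : EN N → ℝ} (hh : ContDiff ℝ (⊤ : ℕ∞) h) (h0 : h 0 = 0)
    (hφ : φ ∈ testSpace A) : h ∘ φ ∈ testSpace A :=
  ⟨hh.comp hφ.1, hφ.2.1.comp_left h0,
    (closure_mono (Function.support_comp_subset h0 φ)).trans hφ.2.2⟩

lemma mul_mem_testSpace {g φ : EN N → ℝ} (hg : ContDiff ℝ (⊤ : ℕ∞) g)
    (hφ : φ ∈ testSpace A) : g * φ ∈ testSpace A :=
  ⟨hg.mul hφ.1, hφ.2.1.mul_left, (tsupport_mul_subset_right (f := g)).trans hφ.2.2⟩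

lemma continuous_gradient_of_mem {φ : EN N → ℝ} (hφ : φ ∈ testSpace A) :
    Continuous (gradient φ) :=
  (InnerProductSpace.toDual ℝ (EN N)).symm.continuous.comp (hφ.1.continuous_fderiv (by simp))

lemma hasCompactSupport_gradient_of_mem {φ : EN N → ℝ} (hφ : φ ∈ testSpace A) :
    HasCompactSupport (gradient φ) :=
  (hφ.2.1.fderiv (𝕜 := ℝ)).comp_left (g := (InnerProductSpace.toDual ℝ (EN N)).symm) (map_zero _)

lemma gradient_eq_zero_of_notMem {φ : EN N → ℝ} (hφ : φ ∈ testSpace A) {x : EN N} (hx : x ∉ A) :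
    gradient φ x = 0 := by
  have : fderiv ℝ φ x = 0 := by
    by_contra h
    exact hx (hφ.2.2 (support_fderiv_subset ℝ h))
  simp [gradient, this]

lemma memLp_gradient_of_mem {φ : EN N → ℝ} (hφ : φ ∈ testSpace A) :
    MemLp (gradient φ) 2 (volume.restrict A) :=
  ((continuous_gradient_of_mem hφ).memLp_of_hasCompactSupport
    (hasCompactSupport_gradient_of_mem hφ)).restrict A

/-- The gradient of a test function, as an element of `L²(A;ℝ^N)`. -/
def gradLp (A : Set (EN N)) : testSpace A →ₗ[ℝ] L2 A where
  toFun φ := (memLp_gradient_of_mem φ.2).toLp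
  map_add' φ ψ := by
    rw [← MemLp.toLp_add]
    refine MemLp.toLp_congr _ _ (ae_of_all _ fun x => ?_)
    exact gradient_add_of_differentiableAt (testSpace_differentiable φ.2 x)
      (testSpace_differentiable ψ.2 x)
  map_smul' c φ := by
    rw [RingHom.id_apply, ← MemLp.toLp_const_smul]
    refine MemLp.toLp_congr _ _ (ae_of_all _ fun x => ?_)
    simp only [gradient, Submodule.coe_smul, Pi.smul_apply]
    rw [fderiv_const_smul (testSpace_differentiable φ.2 x)]
    simp only [map_smulₛₗ, conj_trivial]

lemma coeFn_gradLp (φ : testSpace A) :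
    (gradLp A φ : EN N → EN N) =ᵐ[volume.restrict A] gradient (φ : EN N → ℝ) :=
  (memLp_gradient_of_mem φ.2).coeFn_toLp

lemma inner_gradLp (z : L2 A) (φ : testSpace A) :
    ⟪z, gradLp A φ⟫ = ∫ x in A, ⟪z x, gradient (φ : EN N → ℝ) x⟫ := by
  rw [L2.inner_def]
  refine integral_congr_ae ?_
  filter_upwards [coeFn_gradLp φ] with x hx
  rw [hx]

lemma inner_gradLp_gradLp (φ ψ : testSpace A) :
    ⟪gradLp A φ, gradLp A ψ⟫ =
      ∫ x, ⟪gradient (φ : EN N → ℝ) x, gradient (ψ : EN N → ℝ) x⟫ := by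
  rw [inner_gradLp]
  refine Eq.trans ?_ (setIntegral_eq_integral_of_forall_compl_eq_zero (s := A) ?_)
  · refine integral_congr_ae ?_
    filter_upwards [coeFn_gradLp φ] with x hx
    rw [hx]
  · intro x hx
    rw [gradient_eq_zero_of_notMem ψ.2 hx, inner_zero_right]

lemma integrable_inner_gradient (φ ψ : testSpace A) :
    Integrable (fun x => ⟪gradient (φ : EN N → ℝ) x, gradient (ψ : EN N → ℝ) x⟫) := by
  refine (Continuous.inner (𝕜 := ℝ) (continuous_gradient_of_mem φ.2)
    (continuous_gradient_of_mem ψ.2)).integrable_of_hasCompactSupport ?_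
  refine (hasCompactSupport_gradient_of_mem φ.2).mono fun x hx h0 => hx ?_
  change ⟪gradient (φ : EN N → ℝ) x, _⟫ = 0
  rw [h0, inner_zero_left]

lemma inner_gradLp_mono {φ₁ ψ₁ φ₂ ψ₂ : testSpace A}
    (h : ∀ x, ⟪gradient (φ₁ : EN N → ℝ) x, gradient (ψ₁ : EN N → ℝ) x⟫ ≤
      ⟪gradient (φ₂ : EN N → ℝ) x, gradient (ψ₂ : EN N → ℝ) x⟫) :
    ⟪gradLp A φ₁, gradLp A ψ₁⟫ ≤ ⟪gradLp A φ₂, gradLp A ψ₂⟫ := by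
  rw [inner_gradLp_gradLp, inner_gradLp_gradLp]
  exact integral_mono (integrable_inner_gradient _ _) (integrable_inner_gradient _ _) h

/-- Integration by parts against a fixed test function: the Dirichlet pairing is controlled by the
sup norm of the other function. -/
lemma exists_abs_inner_gradLp_le (v : testSpace A) :
    ∃ C : ℝ, 0 ≤ C ∧ ∀ (κ : testSpace A) (M : ℝ), (∀ x, |(κ : EN N → ℝ) x| ≤ M) →
      |⟪gradLp A v, gradLp A κ⟫| ≤ C * M := by
  let b := EuclideanSpace.basisFun (Fin N) ℝ
  let d : Fin N → EN N → ℝ := fun i x => fderiv ℝ (v : EN N → ℝ) x (b i)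
  have hd : ∀ i, ContDiff ℝ (⊤ : ℕ∞) (d i) := fun i =>
    (v.2.1.fderiv_right (m := (⊤ : ℕ∞)) (by simp)).clm_apply contDiff_const
  have hdc : ∀ i, HasCompactSupport (d i) := fun i =>
    (v.2.2.1.fderiv (𝕜 := ℝ)).comp_left (g := fun L : EN N →L[ℝ] ℝ => L (b i)) (by simp)
  let dd : Fin N → EN N → ℝ := fun i x => fderiv ℝ (d i) x (b i)
  have hdd : ∀ i, Continuous (dd i) := fun i =>
    ((hd i).continuous_fderiv (by simp)).clm_apply continuous_const
  have hddc : ∀ i, HasCompactSupport (dd i) := fun i =>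
    ((hdc i).fderiv (𝕜 := ℝ)).comp_left (g := fun L : EN N →L[ℝ] ℝ => L (b i)) (by simp)
  have hddi : ∀ i, Integrable (dd i) := fun i =>
    (hdd i).integrable_of_hasCompactSupport (hddc i)
  refine ⟨∑ i, ∫ x, |dd i x|, Finset.sum_nonneg fun i _ => integral_nonneg fun x => abs_nonneg _,
    fun κ M hM => ?_⟩
  have hκd := testSpace_differentiable κ.2
  have hκ' : ∀ i, Continuous fun x => fderiv ℝ (κ : EN N → ℝ) x (b i) := fun i =>
    (κ.2.1.continuous_fderiv (by simp)).clm_apply continuous_const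
  have h1 : ∀ i, Integrable fun x => d i x * fderiv ℝ (κ : EN N → ℝ) x (b i) := fun i =>
    ((hd i).continuous.mul (hκ' i)).integrable_of_hasCompactSupport ((hdc i).mul_right)
  have h2 : ∀ i, Integrable fun x => dd i x * (κ : EN N → ℝ) x := fun i =>
    ((hdd i).mul κ.2.1.continuous).integrable_of_hasCompactSupport ((hddc i).mul_right)
  have h3 : ∀ i, Integrable fun x => d i x * (κ : EN N → ℝ) x := fun i =>
    ((hd i).continuous.mul κ.2.1.continuous).integrable_of_hasCompactSupport ((hdc i).mul_right)
  have key : ⟪gradLp A v, gradLp A κ⟫ = -∑ i, ∫ x, dd i x * (κ : EN N → ℝ) x := by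
    rw [inner_gradLp_gradLp, ← Finset.sum_neg_distrib]
    have : ∀ x, ⟪gradient (v : EN N → ℝ) x, gradient (κ : EN N → ℝ) x⟫ =
        ∑ i, d i x * fderiv ℝ (κ : EN N → ℝ) x (b i) := by
      intro x
      rw [← b.sum_inner_mul_inner]
      refine Finset.sum_congr rfl fun i _ => ?_
      rw [inner_gradient_left, inner_gradient_right, conj_trivial]
    simp_rw [this]
    rw [integral_finsetSum _ fun i _ => h1 i]
    refine Finset.sum_congr rfl fun i _ => ?_
    exact integral_mul_fderiv_eq_neg_fderiv_mul_of_integrable (h2 i) (h1 i) (h3 i)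
      (fun x _ => (hd i).differentiable (by simp) x) (fun x _ => hκd x)
  rw [key, abs_neg, Finset.sum_mul]
  refine (Finset.abs_sum_le_sum_abs _ _).trans (Finset.sum_le_sum fun i _ => ?_)
  refine (abs_integral_le_integral_abs).trans ?_
  rw [← integral_mul_const]
  refine integral_mono (h2 i).abs ((hddi i).abs.mul_const M) fun x => ?_
  simp only [abs_mul]
  exact mul_le_mul_of_nonneg_left (hM x) (abs_nonneg _)

end TestSpace

/-- Near-minimizers of `w ↦ ½‖x + G w‖² + L w` on a convex set, with a strongly convergent
sequence of residuals. -/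
lemma exists_almost_minimizers {E V : Type*} [NormedAddCommGroup E] [InnerProductSpace ℝ E]
    [CompleteSpace E] [AddCommGroup V] [Module ℝ V] (G : V →ₗ[ℝ] E) (L : V →ₗ[ℝ] ℝ)
    {C : Set V} (hC : Convex ℝ C) (h0 : C.Nonempty) (hL : ∀ w ∈ C, 0 ≤ L w) (x : E) :
    ∃ (w : ℕ → V) (ε : ℕ → ℝ) (q : E), (∀ n, w n ∈ C) ∧ Tendsto ε atTop (𝓝 0) ∧
      Tendsto (fun n => x + G (w n)) atTop (𝓝 q) ∧
      ∀ n φ, w n + φ ∈ C → -ε n ≤ ⟪x + G (w n), G φ⟫ + ‖G φ‖ ^ 2 / 2 + L φ := by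
  let F : V → ℝ := fun w => ‖x + G w‖ ^ 2 / 2 + L w
  let m : ℝ := sInf (F '' C)
  have hbdd : BddBelow (F '' C) := by
    refine ⟨0, ?_⟩
    rintro _ ⟨w, hw, rfl⟩
    have := hL w hw
    positivity
  have hm : ∀ w ∈ C, m ≤ F w := fun w hw => csInf_le hbdd ⟨w, hw, rfl⟩
  have hex : ∀ n : ℕ, ∃ w ∈ C, F w < m + 1 / ((n : ℝ) + 1) := fun n => by
    obtain ⟨_, ⟨w, hw, rfl⟩, h⟩ := exists_lt_of_csInf_lt (h0.image F)
      (lt_add_of_pos_right m (Nat.one_div_pos_of_nat (α := ℝ) (n := n)))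
    exact ⟨w, hw, h⟩
  choose w hwC hwF using hex
  have hε : Tendsto (fun n : ℕ => 1 / ((n : ℝ) + 1)) atTop (𝓝 0) :=
    tendsto_one_div_add_atTop_nhds_zero_nat
  have hpar : ∀ a ∈ C, ∀ b ∈ C, ‖G a - G b‖ ^ 2 ≤ 4 * (F a - m) + 4 * (F b - m) := by
    intro a ha b hb
    have hmid : (1 / 2 : ℝ) • a + (1 / 2 : ℝ) • b ∈ C :=
      hC ha hb (by norm_num) (by norm_num) (by norm_num)
    have h1 := hm _ hmid
    have h2 : x + G ((1 / 2 : ℝ) • a + (1 / 2 : ℝ) • b) =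
        (1 / 2 : ℝ) • ((x + G a) + (x + G b)) := by
      simp only [map_add, map_smul]
      module
    have h3 := parallelogram_law_with_norm ℝ (x + G a) (x + G b)
    simp only [F] at h1 ⊢
    rw [h2, norm_smul, map_add, map_smul, map_smul] at h1
    rw [add_sub_add_left_eq_sub] at h3
    norm_num [mul_pow] at h1
    nlinarith
  have hcau : CauchySeq fun n => x + G (w n) := by
    rw [Metric.cauchySeq_iff']
    intro η hη
    have : ∀ᶠ n : ℕ in atTop, 1 / ((n : ℝ) + 1) < η ^ 2 / 8 :=
      hε.eventually_lt_const (by positivity)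
    obtain ⟨n₀, hn₀⟩ := eventually_atTop.1 this
    refine ⟨n₀, fun n hn => ?_⟩
    rw [dist_eq_norm, add_sub_add_left_eq_sub]
    refine lt_of_pow_lt_pow_left₀ 2 hη.le ?_
    have := hpar _ (hwC n) _ (hwC n₀)
    have := hwF n
    have := hwF n₀
    have := hn₀ n hn
    have := hn₀ n₀ le_rfl
    linarith
  obtain ⟨q, hq⟩ := cauchySeq_tendsto_of_complete hcau
  refine ⟨w, _, q, hwC, hε, hq, fun n φ hφ => ?_⟩
  have h1 := hm _ hφ
  have h2 := hwF n
  simp only [F, map_add, ← add_assoc] at h1 h2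
  rw [norm_add_sq_real] at h1
  linarith

lemma nonneg_of_forall_small {a b δ₀ : ℝ} (hδ₀ : 0 < δ₀)
    (h : ∀ δ, 0 < δ → δ ≤ δ₀ → 0 ≤ a + δ * b) : 0 ≤ a := by
  have ht : Tendsto (fun δ : ℝ => a + δ * b) (𝓝[>] 0) (𝓝 a) := by
    have : Continuous fun δ : ℝ => a + δ * b := by fun_prop
    simpa using (this.tendsto 0).mono_left nhdsWithin_le_nhds
  refine ge_of_tendsto ht ?_
  filter_upwards [Ioc_mem_nhdsGT hδ₀] with δ hδ
  exact h δ hδ.1 hδ.2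

section DivergenceBound

variable {N : ℕ} {A : Set (EN N)}

/-- The nonnegative test functions. -/
def nonnegTest (A : Set (EN N)) : Set (testSpace A) := {φ | ∀ x, 0 ≤ (φ : EN N → ℝ) x}

lemma convex_nonnegTest : Convex ℝ (nonnegTest A) := by
  intro φ hφ ψ hψ a b ha hb _ x
  exact add_nonneg (mul_nonneg ha (hφ x)) (mul_nonneg hb (hψ x))

/-- The fields whose divergence is bounded above by the functional `L` on nonnegative test
functions. -/
def divLE (A : Set (EN N)) (L : testSpace A →ₗ[ℝ] ℝ) : Set (L2 A) :=
  {z | ∀ φ ∈ nonnegTest A, 0 ≤ ⟪z, gradLp A φ⟫ + L φ}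

lemma isClosed_divLE (L : testSpace A →ₗ[ℝ] ℝ) : IsClosed (divLE A L) := by
  have : divLE A L = ⋂ φ ∈ nonnegTest A, {z : L2 A | 0 ≤ ⟪z, gradLp A φ⟫ + L φ} := by
    ext z
    simp [divLE]
  rw [this]
  refine isClosed_biInter fun φ _ => isClosed_le continuous_const ?_
  fun_prop

lemma neg_inner_gradLp_le_toReal {z : L2 A} (hz : divTV A ⇑z ≠ ⊤) (v : testSpace A)
    (hv : ∀ x, |(v : EN N → ℝ) x| ≤ 1) : -⟪z, gradLp A v⟫ ≤ (divTV A ⇑z).toReal := by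
  rw [inner_gradLp]
  refine (ENNReal.ofReal_le_iff_le_toReal hz).1 ?_
  exact le_iSup (fun v : {v : EN N → ℝ // TestFn A v} =>
    ENNReal.ofReal (-∫ x in A, ⟪z x, gradient (v : EN N → ℝ) x⟫))
    ⟨v, v.2.1, v.2.2.1, v.2.2.2, hv⟩

lemma divTV_le_of_forall {z : L2 A} {D : ℝ≥0∞} (hD : D ≠ ⊤)
    (h : ∀ v : testSpace A, (∀ x, |(v : EN N → ℝ) x| ≤ 1) → -⟪z, gradLp A v⟫ ≤ D.toReal) :
    divTV A ⇑z ≤ D := by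
  refine iSup_le fun v => (ENNReal.ofReal_le_iff_le_toReal hD).2 ?_
  rw [← inner_gradLp z ⟨v, v.2.1, v.2.2.1, v.2.2.2.1⟩]
  exact h _ v.2.2.2.2

/-- A smooth approximation of the indicator function of `(0, ∞)`. -/
def softStep (ρ r : ℝ) : ℝ := r ^ 2 / (ρ ^ 2 + r ^ 2)

/-- The primitive of `1 - softStep ρ` vanishing at zero. -/
def softRem (ρ r : ℝ) : ℝ := ρ * Real.arctan (r / ρ)

section SoftStep

variable {ρ : ℝ}

lemma contDiff_softStep (hρ : 0 < ρ) : ContDiff ℝ (⊤ : ℕ∞) (softStep ρ) :=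
  ContDiff.div (by fun_prop) (by fun_prop) fun r => by positivity

lemma contDiff_softRem : ContDiff ℝ (⊤ : ℕ∞) (softRem ρ) :=
  contDiff_const.mul (Real.contDiff_arctan.comp (contDiff_id.div_const ρ))

lemma softStep_nonneg (r : ℝ) : 0 ≤ softStep ρ r := by
  unfold softStep; positivity

lemma softStep_le_one (hρ : 0 < ρ) (r : ℝ) : softStep ρ r ≤ 1 := by
  unfold softStep
  rw [div_le_one (by positivity)]
  nlinarith

lemma two_mul_softStep_le (hρ : 0 < ρ) {r : ℝ} (hr : 0 ≤ r) : ρ * (2 * softStep ρ r) ≤ r := by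
  have h : ρ * (2 * softStep ρ r) = (2 * ρ * r ^ 2) / (ρ ^ 2 + r ^ 2) := by
    unfold softStep; ring
  rw [h, div_le_iff₀ (by positivity)]
  nlinarith [mul_nonneg hr (sq_nonneg (ρ - r))]

lemma hasDerivAt_softStep (hρ : 0 < ρ) (r : ℝ) :
    HasDerivAt (softStep ρ) (2 * r * ρ ^ 2 / (ρ ^ 2 + r ^ 2) ^ 2) r := by
  have h1 : HasDerivAt (fun r : ℝ => r ^ 2) (2 * r) r := by simpa using hasDerivAt_pow 2 r
  have h2 := h1.div (h1.const_add (ρ ^ 2)) (by positivity)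
  refine h2.congr_deriv ?_
  congr 1
  ring

lemma deriv_softStep_le (hρ : 0 < ρ) (r : ℝ) :
    2 * r * ρ ^ 2 / (ρ ^ 2 + r ^ 2) ^ 2 ≤ 1 / ρ := by
  rw [div_le_div_iff₀ (by positivity) hρ]
  have h1 : 2 * r * ρ ≤ ρ ^ 2 + r ^ 2 := by nlinarith [sq_nonneg (ρ - r)]
  have h2 : ρ ^ 2 ≤ ρ ^ 2 + r ^ 2 := by nlinarith
  calc 2 * r * ρ ^ 2 * ρ = (2 * r * ρ) * ρ ^ 2 := by ring
    _ ≤ (ρ ^ 2 + r ^ 2) * (ρ ^ 2 + r ^ 2) := by gcongr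
    _ = 1 * (ρ ^ 2 + r ^ 2) ^ 2 := by ring

lemma hasDerivAt_softRem (hρ : 0 < ρ) (r : ℝ) :
    HasDerivAt (softRem ρ) (1 - softStep ρ r) r := by
  have h := (((hasDerivAt_id r).div_const ρ).arctan).const_mul ρ
  refine h.congr_deriv ?_
  simp only [softStep, id]
  field_simp
  ring

lemma abs_softRem_le (hρ : 0 < ρ) (r : ℝ) : |softRem ρ r| ≤ 2 * ρ := by
  have h1 := Real.arctan_lt_pi_div_two (r / ρ)
  have h2 := Real.neg_pi_div_two_lt_arctan (r / ρ)
  have h3 := Real.pi_lt_four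
  unfold softRem
  rw [abs_mul, abs_of_pos hρ, mul_comm]
  gcongr
  exact abs_le.2 ⟨by linarith, by linarith⟩

end SoftStep

/-- Truncated competitor: given nonnegative `w` and `|v| ≤ 1`, the function
`ψ = (1 - v) * softStep ρ w` is an admissible direction at `w`. -/
lemma exists_direction (w v : testSpace A) (hw : w ∈ nonnegTest A)
    (hv : ∀ x, |(v : EN N → ℝ) x| ≤ 1) {ρ : ℝ} (hρ : 0 < ρ) :
    ∃ ψ κ : testSpace A, ψ ∈ nonnegTest A ∧
      (∀ δ, 0 < δ → δ ≤ ρ → w + (-δ) • ψ ∈ nonnegTest A) ∧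
      (∀ x, |((v + ψ : testSpace A) : EN N → ℝ) x| ≤ 1) ∧
      (∀ x, |(κ : EN N → ℝ) x| ≤ 2 * ρ) ∧
      ⟪gradLp A v, gradLp A κ⟫ ≤ ⟪gradLp A w, gradLp A (v + ψ)⟫ ∧
      ‖gradLp A ψ‖ ^ 2 ≤ 2 * ‖gradLp A v‖ ^ 2 + 8 / ρ ^ 2 * ‖gradLp A w‖ ^ 2 := by
  have hSw := comp_mem_testSpace (contDiff_softStep hρ) (by simp [softStep]) w.2
  have h1v : ContDiff ℝ (⊤ : ℕ∞) (1 - (v : EN N → ℝ)) := contDiff_const.sub v.2.1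
  let ψ : testSpace A := ⟨(1 - (v : EN N → ℝ)) * (softStep ρ ∘ w), mul_mem_testSpace h1v hSw⟩
  let κ : testSpace A :=
    ⟨softRem ρ ∘ w, comp_mem_testSpace contDiff_softRem (by simp [softRem]) w.2⟩
  have hv1 : ∀ x, -1 ≤ (v : EN N → ℝ) x := fun x => (abs_le.1 (hv x)).1
  have hv2 : ∀ x, (v : EN N → ℝ) x ≤ 1 := fun x => (abs_le.1 (hv x)).2
  have hψx : ∀ x, (ψ : EN N → ℝ) x = (1 - (v : EN N → ℝ) x) * softStep ρ ((w : EN N → ℝ) x) :=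
    fun x => rfl
  have hvd := testSpace_differentiable v.2
  have hwd := testSpace_differentiable w.2
  let s' : EN N → ℝ := fun x =>
    2 * (w : EN N → ℝ) x * ρ ^ 2 / (ρ ^ 2 + (w : EN N → ℝ) x ^ 2) ^ 2
  have hs0 : ∀ x, 0 ≤ s' x := fun x => by
    have := hw x
    positivity
  have hs1 : ∀ x, s' x ≤ 1 / ρ := fun x => deriv_softStep_le hρ _
  have hgψ : ∀ x, gradient (ψ : EN N → ℝ) x =
      ((1 - (v : EN N → ℝ) x) * s' x) • gradient (w : EN N → ℝ) x -
        softStep ρ ((w : EN N → ℝ) x) • gradient (v : EN N → ℝ) x := by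
    intro x
    have e1 : gradient (1 - (v : EN N → ℝ)) x = -gradient (v : EN N → ℝ) x := by
      have : fderiv ℝ (1 - (v : EN N → ℝ)) x = -fderiv ℝ (v : EN N → ℝ) x :=
        fderiv_const_sub (1 : ℝ)
      simp only [gradient, this, map_neg]
    have e2 : gradient (softStep ρ ∘ (w : EN N → ℝ)) x = s' x • gradient (w : EN N → ℝ) x :=
      gradient_comp_of_hasDerivAt (hasDerivAt_softStep hρ _) (hwd x)
    have e3 : gradient (ψ : EN N → ℝ) x = _ :=
      gradient_mul_of_differentiableAt (h1v.differentiable (by simp) x)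
        (testSpace_differentiable hSw x)
    rw [e3, e1, e2, smul_smul, smul_neg, ← sub_eq_add_neg]
    rfl
  have hgκ : ∀ x, gradient (κ : EN N → ℝ) x =
      (1 - softStep ρ ((w : EN N → ℝ) x)) • gradient (w : EN N → ℝ) x := fun x =>
    gradient_comp_of_hasDerivAt (hasDerivAt_softRem hρ _) (hwd x)
  refine ⟨ψ, κ, fun x => ?_, fun δ hδ hδρ x => ?_, fun x => ?_, fun x => abs_softRem_le hρ _,
    inner_gradLp_mono fun x => ?_, ?_⟩
  · exact mul_nonneg (sub_nonneg.2 (hv2 x)) (softStep_nonneg _)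
  · have h1 := two_mul_softStep_le hρ (hw x)
    have h2 := softStep_nonneg (ρ := ρ) ((w : EN N → ℝ) x)
    have h3 : δ * ((1 - (v : EN N → ℝ) x) * softStep ρ ((w : EN N → ℝ) x)) ≤
        ρ * (2 * softStep ρ ((w : EN N → ℝ) x)) := by
      have := hv1 x
      have := hv2 x
      gcongr
      linarith
    change 0 ≤ (w : EN N → ℝ) x + (-δ) * ((1 - (v : EN N → ℝ) x) * softStep ρ ((w : EN N → ℝ) x))
    linarith
  · change |(v : EN N → ℝ) x + (1 - (v : EN N → ℝ) x) * softStep ρ ((w : EN N → ℝ) x)| ≤ 1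
    have h1 := softStep_nonneg (ρ := ρ) ((w : EN N → ℝ) x)
    have h2 := softStep_le_one hρ ((w : EN N → ℝ) x)
    have h3 := hv1 x
    have h4 := hv2 x
    exact abs_le.2 ⟨by nlinarith, by nlinarith⟩
  · have e : gradient ((v + ψ : testSpace A) : EN N → ℝ) x =
        gradient (v : EN N → ℝ) x + gradient (ψ : EN N → ℝ) x :=
      gradient_add_of_differentiableAt (hvd x) (testSpace_differentiable ψ.2 x)
    rw [e, hgψ, hgκ]
    simp only [inner_add_right, inner_sub_right, inner_smul_right, real_inner_self_eq_norm_sq]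
    rw [real_inner_comm]
    have : 0 ≤ (1 - (v : EN N → ℝ) x) * s' x * ‖gradient (w : EN N → ℝ) x‖ ^ 2 :=
      mul_nonneg (mul_nonneg (sub_nonneg.2 (hv2 x)) (hs0 x)) (sq_nonneg _)
    linarith
  · simp only [← real_inner_self_eq_norm_sq, inner_gradLp_gradLp]
    rw [← integral_const_mul, ← integral_const_mul, ← integral_add
      ((integrable_inner_gradient v v).const_mul _) ((integrable_inner_gradient w w).const_mul _)]
    refine integral_mono (integrable_inner_gradient ψ ψ)
      (((integrable_inner_gradient v v).const_mul _).add
        ((integrable_inner_gradient w w).const_mul _)) fun x => ?_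
    simp only [real_inner_self_eq_norm_sq, hgψ]
    have hb : ‖((1 - (v : EN N → ℝ) x) * s' x) • gradient (w : EN N → ℝ) x -
        softStep ρ ((w : EN N → ℝ) x) • gradient (v : EN N → ℝ) x‖ ≤
        2 / ρ * ‖gradient (w : EN N → ℝ) x‖ + ‖gradient (v : EN N → ℝ) x‖ := by
      refine (norm_sub_le _ _).trans (add_le_add ?_ ?_)
      · rw [norm_smul, Real.norm_of_nonneg (mul_nonneg (sub_nonneg.2 (hv2 x)) (hs0 x))]
        gcongr
        calc (1 - (v : EN N → ℝ) x) * s' x ≤ 2 * (1 / ρ) :=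
              mul_le_mul (by linarith [hv1 x]) (hs1 x) (hs0 x) (by norm_num)
          _ = 2 / ρ := by ring
      · rw [norm_smul, Real.norm_of_nonneg (softStep_nonneg _)]
        exact mul_le_of_le_one_left (norm_nonneg _) (softStep_le_one hρ _)
    have hb2 := pow_le_pow_left₀ (norm_nonneg _) hb 2
    have e : 8 / ρ ^ 2 * ‖gradient (w : EN N → ℝ) x‖ ^ 2 =
        2 * (2 / ρ * ‖gradient (w : EN N → ℝ) x‖) ^ 2 := by ring
    rw [e]
    nlinarith [sq_nonneg (2 / ρ * ‖gradient (w : EN N → ℝ) x‖ - ‖gradient (v : EN N → ℝ) x‖)]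

/-- Projecting onto a set of fields with divergence bounded above by a positive functional does not
increase the total variation of the divergence. -/
lemma exists_projection_divLE (L : testSpace A →ₗ[ℝ] ℝ) (hL : ∀ φ ∈ nonnegTest A, 0 ≤ L φ)
    {x : L2 A} (hx : divTV A ⇑x ≠ ⊤) :
    ∃ q ∈ divLE A L, (∀ z ∈ divLE A L, ⟪x - q, z - q⟫ ≤ 0) ∧ divTV A ⇑q ≤ divTV A ⇑x := by
  obtain ⟨w, ε, q, hw, hε, hq, hmin⟩ := exists_almost_minimizers (gradLp A) L convex_nonnegTest
    ⟨0, fun _ => le_rfl⟩ hL x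
  have hg : Tendsto (fun n => gradLp A (w n)) atTop (𝓝 (q - x)) := by
    simpa using hq.sub_const x
  have hε' : Tendsto (fun n => -ε n) atTop (𝓝 0) := by simpa using hε.neg
  refine ⟨q, fun φ hφ => ?_, fun z hz => ?_, divTV_le_of_forall hx fun v hv => ?_⟩
  · refine nonneg_of_forall_small (b := ‖gradLp A φ‖ ^ 2 / 2) one_pos fun δ hδ _ => ?_
    have h1 : ∀ n, -ε n ≤ δ * (⟪x + gradLp A (w n), gradLp A φ⟫ + L φ +
        δ * (‖gradLp A φ‖ ^ 2 / 2)) := by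
      intro n
      have := hmin n (δ • φ) fun y => add_nonneg (hw n y) (mul_nonneg hδ.le (hφ y))
      rw [map_smul, map_smul, inner_smul_right, norm_smul, mul_pow, Real.norm_of_nonneg hδ.le,
        smul_eq_mul] at this
      linarith
    have h2 := le_of_tendsto_of_tendsto' hε'
      (((((hq.inner tendsto_const_nhds).add_const _).add_const _).const_mul δ)) h1
    exact nonneg_of_mul_nonneg_right h2 hδ
  · have key : 0 ≤ ⟪z, q - x⟫ - ⟪q, q - x⟫ := by
      refine nonneg_of_forall_small (b := ‖q - x‖ ^ 2 / 2) one_pos fun δ hδ hδ1 => ?_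
      have h1 : ∀ n, -ε n ≤ δ * (⟪z, gradLp A (w n)⟫ - ⟪x + gradLp A (w n), gradLp A (w n)⟫ +
          δ * (‖gradLp A (w n)‖ ^ 2 / 2)) := by
        intro n
        have := hmin n ((-δ) • w n) fun y => by
          change 0 ≤ (w n : EN N → ℝ) y + (-δ) * (w n : EN N → ℝ) y
          nlinarith [hw n y]
        rw [map_smul, map_smul, inner_smul_right, norm_smul, mul_pow, norm_neg,
          Real.norm_of_nonneg hδ.le, smul_eq_mul] at this
        nlinarith [mul_nonneg hδ.le (hz _ (hw n))]
      have h2 := le_of_tendsto_of_tendsto' hε'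
        (((((tendsto_const_nhds.inner hg).sub (hq.inner hg)).add
          (((hg.norm.pow 2).div_const 2).const_mul δ)).const_mul δ)) h1
      exact nonneg_of_mul_nonneg_right h2 hδ
    rw [← inner_sub_left, real_inner_comm, ← neg_sub x q, inner_neg_left] at key
    linarith
  · obtain ⟨C, hC, hCb⟩ := exists_abs_inner_gradLp_le v
    rw [← sub_nonneg]
    refine nonneg_of_forall_small (b := C * 2) one_pos fun ρ hρ _ => ?_
    refine nonneg_of_forall_small
      (b := (2 * ‖gradLp A v‖ ^ 2 + 8 / ρ ^ 2 * ‖q - x‖ ^ 2) / 2) hρ fun δ hδ hδρ => ?_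
    have h1 : ∀ n, -ε n ≤ δ * ((divTV A ⇑x).toReal - -⟪x + gradLp A (w n), gradLp A v⟫ +
        ρ * (C * 2) +
        δ * ((2 * ‖gradLp A v‖ ^ 2 + 8 / ρ ^ 2 * ‖gradLp A (w n)‖ ^ 2) / 2)) := by
      intro n
      obtain ⟨ψ, κ, hψ, hadm, hvψ, hκ, hin, hnorm⟩ := exists_direction (w n) v (hw n) hv hρ
      have a1 := hmin n _ (hadm δ hδ hδρ)
      rw [map_smul, map_smul, inner_smul_right, norm_smul, mul_pow, norm_neg,
        Real.norm_of_nonneg hδ.le, smul_eq_mul] at a1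
      have a2 := neg_inner_gradLp_le_toReal hx (v + ψ) hvψ
      have a3 := (abs_le.1 (hCb κ _ hκ)).1
      have a4 := hL ψ hψ
      have a5 : ⟪x + gradLp A (w n), gradLp A ψ⟫ =
          ⟪x, gradLp A (v + ψ)⟫ + ⟪gradLp A (w n), gradLp A (v + ψ)⟫ -
            ⟪x + gradLp A (w n), gradLp A v⟫ := by
        rw [← inner_add_left, ← inner_sub_right, map_add, add_sub_cancel_left]
      have a6 : -⟪x + gradLp A (w n), gradLp A ψ⟫ ≤ (divTV A ⇑x).toReal -
          -⟪x + gradLp A (w n), gradLp A v⟫ + ρ * (C * 2) := by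
        linarith
      have a7 := mul_le_mul_of_nonneg_left a6 hδ.le
      have a8 := mul_le_mul_of_nonneg_left hnorm (sq_nonneg δ)
      have a9 := mul_nonneg hδ.le a4
      linarith
    have h2 := le_of_tendsto_of_tendsto' hε'
      ((((((hq.inner tendsto_const_nhds).neg.const_sub _).add_const _).add
        ((((((hg.norm.pow 2).const_mul _).const_add _).div_const 2).const_mul δ))).const_mul δ))
      h1
    exact nonneg_of_mul_nonneg_right h2 hδ

end DivergenceBound

section Flow

variable {N : ℕ} {A : Set (EN N)}

/-- Invariance of the upper divergence bounds under the gradient flow. -/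
lemma IsGradFlow.mem_divLE {u0 : L2 A} {u : ℝ → L2 A} (hu : IsGradFlow A u0 u)
    (L : testSpace A →ₗ[ℝ] ℝ) (hL : ∀ φ ∈ nonnegTest A, 0 ≤ L φ) {s t : ℝ} (hs : 0 ≤ s)
    (hst : s < t) (h : u s ∈ divLE A L) : u t ∈ divLE A L := by
  obtain ⟨hcont, -, hflow⟩ := hu
  have hne : (divLE A L).Nonempty := ⟨_, h⟩
  let f : ℝ → ℝ := fun τ => infDist (u τ) (divLE A L) ^ 2
  have hfc : ContinuousOn f (Ici 0) :=
    ((continuous_infDist_pt _).comp_continuousOn hcont).pow 2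
  have hmono : ∀ a ∈ Ioo s t, f t ≤ f a := by
    intro a ha
    have ha0 : 0 < a := hs.trans_lt ha.1
    refine image_le_of_liminf_slope_right_le_deriv_boundary (f := f) (a := a) (b := t)
      (B := fun _ => f a) (B' := fun _ => 0) (hfc.mono fun y hy => ha0.le.trans hy.1) le_rfl
      continuousOn_const (fun x _ => hasDerivWithinAt_const _ _ _) ?_ ⟨ha.2.le, le_rfl⟩
    intro x hx r hr
    obtain ⟨p, hp, hfin, hsub⟩ := hflow x (ha0.trans_le hx.1)
    obtain ⟨q, hqK, hproj, hqle⟩ := exists_projection_divLE L hL hfin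
    have hp' : HasDerivWithinAt u p (Ioi x) x := by
      rw [hasDerivWithinAt_iff_tendsto_slope' self_notMem_Ioi]
      have hsh : Tendsto (fun z : ℝ => z - x) (𝓝[>] x) (𝓝[>] 0) := by
        refine tendsto_nhdsWithin_iff.2 ⟨?_, ?_⟩
        · have : Continuous fun z : ℝ => z - x := by fun_prop
          simpa using (this.tendsto x).mono_left nhdsWithin_le_nhds
        · filter_upwards [self_mem_nhdsWithin] with z hz
          exact sub_pos.2 (mem_Ioi.1 hz)
      refine (hp.comp hsh).congr fun z => ?_
      simp [slope_def_module]
    have hfx : f x = ‖u x - q‖ ^ 2 := by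
      have : infDist (u x) (divLE A L) = ‖u x - q‖ := by
        refine le_antisymm ((infDist_le_dist_of_mem hqK).trans_eq (dist_eq_norm _ _)) ?_
        refine (le_infDist hne).2 fun z hz => ?_
        rw [dist_eq_norm]
        refine pow_le_pow_iff_left₀ (norm_nonneg _) (norm_nonneg _) two_ne_zero |>.1 ?_
        have e : u x - z = (u x - q) - (z - q) := by abel
        rw [e, norm_sub_sq_real (u x - q) (z - q)]
        nlinarith [hproj z hz, sq_nonneg ‖z - q‖]
      simp only [f, this]
    have hfz : ∀ z, f z ≤ ‖u z - q‖ ^ 2 := fun z =>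
      pow_le_pow_left₀ infDist_nonneg
        ((infDist_le_dist_of_mem hqK).trans_eq (dist_eq_norm _ _)) 2
    have hd : HasDerivWithinAt (fun z => ‖u z - q‖ ^ 2) (2 * ⟪u x - q, p⟫) (Ioi x) x :=
      (hp'.sub_const q).norm_sq
    have hle : 2 * ⟪u x - q, p⟫ ≤ 0 := by
      have h1 := hsub q (ne_top_of_le_ne_top hfin hqle)
      have h2 := ENNReal.toReal_mono hfin hqle
      rw [← neg_sub (u x) q, inner_neg_neg, real_inner_comm] at h1
      linarith
    rw [hasDerivWithinAt_iff_tendsto_slope' self_notMem_Ioi] at hd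
    refine Eventually.frequently ?_
    filter_upwards [hd.eventually_lt_const (hle.trans_lt hr), self_mem_nhdsWithin] with z hz hxz
    refine lt_of_le_of_lt ?_ hz
    rw [slope_def_field, slope_def_field, hfx]
    have : 0 < z - x := sub_pos.2 hxz
    gcongr
    exact hfz z
  have hft : f t ≤ f s := by
    have ht : Tendsto f (𝓝[>] s) (𝓝 (f s)) :=
      (hfc s hs).mono_left (nhdsWithin_mono _ fun y hy => hs.trans (le_of_lt hy))
    refine ge_of_tendsto ht ?_
    filter_upwards [Ioo_mem_nhdsGT hst] with a ha
    exact hmono a ha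
  have hfs : f s = 0 := by simp [f, infDist_zero_of_mem h]
  rw [(isClosed_divLE L).mem_iff_infDist_zero hne]
  exact pow_eq_zero_iff two_ne_zero |>.1 (le_antisymm (hft.trans_eq hfs) (sq_nonneg _))

lemma divTV_neg_le (z : L2 A) : divTV A ⇑(-z) ≤ divTV A ⇑z := by
  refine iSup_le fun v => ?_
  let v' : testSpace A := ⟨v, v.2.1, v.2.2.1, v.2.2.2.1⟩
  have e : -∫ x in A, ⟪(-z : L2 A) x, gradient (v : EN N → ℝ) x⟫ =
      -∫ x in A, ⟪z x, gradient ((-v' : testSpace A) : EN N → ℝ) x⟫ := by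
    rw [← inner_gradLp z (-v'), map_neg, inner_neg_right, ← inner_neg_left,
      inner_gradLp (-z) v']
  rw [e]
  exact le_iSup (fun v : {v : EN N → ℝ // TestFn A v} =>
    ENNReal.ofReal (-∫ x in A, ⟪z x, gradient (v : EN N → ℝ) x⟫))
    ⟨(-v' : testSpace A), (-v').2.1, (-v').2.2.1, (-v').2.2.2, fun x => by
      change |-(v : EN N → ℝ) x| ≤ 1
      rw [abs_neg]
      exact v.2.2.2.2 x⟩

lemma divTV_neg (z : L2 A) : divTV A ⇑(-z) = divTV A ⇑z :=
  le_antisymm (divTV_neg_le z) (by simpa using divTV_neg_le (-z))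

lemma IsGradFlow.neg {u0 : L2 A} {u : ℝ → L2 A} (hu : IsGradFlow A u0 u) :
    IsGradFlow A (-u0) fun τ => -u τ := by
  obtain ⟨hcont, h0, hflow⟩ := hu
  refine ⟨hcont.neg, congrArg Neg.neg h0, fun t ht => ?_⟩
  obtain ⟨p, hp, hfin, hsub⟩ := hflow t ht
  refine ⟨-p, hp.neg.congr fun h => by rw [← smul_neg, neg_sub_neg, neg_sub],
    by rwa [divTV_neg], fun z hz => ?_⟩
  have h1 := hsub (-z) (by rwa [divTV_neg])
  rw [divTV_neg] at h1 ⊢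
  have e : -z - u t = -(z - -u t) := by abel
  rwa [e, inner_neg_neg, ← neg_neg p] at h1

lemma DivEq.neg {z : L2 A} {μ : SignedMeasure (EN N)} (h : DivEq A ⇑z μ) :
    DivEq A ⇑(-z) (-μ) := by
  intro φ h1 h2 h3
  have := h φ h1 h2 h3
  rw [← inner_gradLp z ⟨φ, h1, h2, h3⟩] at this
  rw [← inner_gradLp (-z) ⟨φ, h1, h2, h3⟩, inner_neg_left, this,
    SignedMeasure.toJordanDecomposition_neg, JordanDecomposition.neg_posPart,
    JordanDecomposition.neg_negPart]
  ring

lemma integrable_of_mem_testSpace {φ : EN N → ℝ} (hφ : φ ∈ testSpace A) (ν : Measure (EN N))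
    [IsFiniteMeasure ν] : Integrable φ ν :=
  hφ.1.continuous.integrable_of_hasCompactSupport hφ.2.1

/-- Integration against a finite measure, as a functional on test functions. -/
def integralTest (A : Set (EN N)) (ν : Measure (EN N)) [IsFiniteMeasure ν] :
    testSpace A →ₗ[ℝ] ℝ where
  toFun φ := ∫ x, (φ : EN N → ℝ) x ∂ν
  map_add' φ ψ :=
    integral_add (integrable_of_mem_testSpace φ.2 ν) (integrable_of_mem_testSpace ψ.2 ν)
  map_smul' c _ := integral_const_mul c _

lemma exists_testSpace_eq_one {K U : Set (EN N)} (hK : IsCompact K) (hU : IsOpen U)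
    (hKU : K ⊆ U) :
    ∃ φ ∈ testSpace U, (∀ x ∈ K, φ x = 1) ∧ ∀ x, φ x ∈ Icc (0 : ℝ) 1 := by
  obtain ⟨K', hK', hKK', hK'U⟩ := exists_compact_between hK hU hKU
  obtain ⟨f, hf1, hf0, hf⟩ := exists_contMDiffMap_one_nhds_of_subset_interior
    (n := (⊤ : ℕ∞)) (modelWithCornersSelf ℝ (EN N)) hK.isClosed hKK'
  have hsupp : tsupport f ⊆ K' :=
    closure_minimal (fun x hx => by_contra fun h => hx (hf0 x h)) hK'.isClosed
  exact ⟨f, ⟨f.contMDiff.contDiff, hK'.of_isClosed_subset (isClosed_tsupport _) hsupp,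
    hsupp.trans hK'U⟩, fun x hx => hf1.self_of_nhdsSet x hx, hf⟩

/-- Comparison of finite measures on an open set, tested on smooth nonnegative functions. -/
lemma measure_le_of_forall_testSpace (hA : IsOpen A) {a b : Measure (EN N)} [IsFiniteMeasure a]
    [IsFiniteMeasure b] (haA : a Aᶜ = 0)
    (h : ∀ φ ∈ testSpace A, (∀ x, 0 ≤ φ x) → ∫ x, φ x ∂a ≤ ∫ x, φ x ∂b) : a ≤ b := by
  have hcompact : ∀ K ⊆ A, IsCompact K → a K ≤ b K := by
    intro K hKA hK
    refine ENNReal.le_of_forall_pos_le_add fun ε hε _ => ?_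
    obtain ⟨U, hKU, hU, hbU⟩ := hK.exists_isOpen_lt_add (μ := b) (ε := ε) (by simpa using hε.ne')
    obtain ⟨φ, hφ, hφ1, hφI⟩ := exists_testSpace_eq_one hK (hU.inter hA)
      (subset_inter hKU hKA)
    have hφA : φ ∈ testSpace A := ⟨hφ.1, hφ.2.1, hφ.2.2.trans inter_subset_right⟩
    have h1 : a.real K ≤ ∫ x, φ x ∂a := by
      rw [← integral_indicator_one hK.measurableSet]
      refine integral_mono ((integrable_const (1 : ℝ)).indicator hK.measurableSet)
        (integrable_of_mem_testSpace hφA a) fun x => ?_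
      by_cases hx : x ∈ K
      · simp [hx, hφ1 x hx]
      · simp [hx, (hφI x).1]
    have h2 : ∫ x, φ x ∂b ≤ b.real U := by
      rw [← integral_indicator_one hU.measurableSet]
      refine integral_mono (integrable_of_mem_testSpace hφA b)
        ((integrable_const (1 : ℝ)).indicator hU.measurableSet) fun x => ?_
      by_cases hx : x ∈ U
      · simp [hx, (hφI x).2]
      · have : φ x = 0 := by
          by_contra h
          exact hx (hφ.2.2 (subset_tsupport φ h)).1
        simp [hx, this]
    have h3 : a K ≤ b U := by
      rw [← ENNReal.toReal_le_toReal (measure_ne_top _ _) (measure_ne_top _ _)]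
      exact h1.trans ((h φ hφA fun x => (hφI x).1).trans h2)
    exact h3.trans hbU.le
  refine Measure.le_iff.2 fun B hB => ?_
  refine ENNReal.le_of_forall_pos_le_add fun ε hε _ => ?_
  obtain ⟨K, hKB, hK, haK⟩ := (hB.inter hA.measurableSet).exists_isCompact_lt_add (μ := a)
    (measure_ne_top _ _) (ε := ε) (by simpa using hε.ne')
  calc a B = a (B ∩ A) := (measure_inter_conull haA).symm
    _ ≤ a K + ε := haK.le
    _ ≤ b K + ε := add_le_add_left (hcompact K (hKB.trans inter_subset_right) hK) _
    _ ≤ b B + ε := add_le_add_left (measure_mono (hKB.trans inter_subset_left)) _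

/-- The positive part of the divergence is nonincreasing along the gradient flow. -/
lemma IsGradFlow.posPart_le (hA : IsOpen A) {u0 : L2 A} {u : ℝ → L2 A} (hu : IsGradFlow A u0 u)
    {s t : ℝ} (hs : 0 ≤ s) (hst : s < t) {μs μt : SignedMeasure (EN N)}
    (hμtA : μt.toJordanDecomposition.posPart Aᶜ = 0)
    (hdivs : DivEq A ⇑(u s) μs) (hdivt : DivEq A ⇑(u t) μt) :
    μt.toJordanDecomposition.posPart ≤ μs.toJordanDecomposition.posPart := by
  let ν := μs.toJordanDecomposition.posPart
  let α := μt.toJordanDecomposition.posPart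
  let β := μt.toJordanDecomposition.negPart
  have hmem : u t ∈ divLE A (integralTest A ν) := by
    refine hu.mem_divLE _ (fun φ hφ => integral_nonneg hφ) hs hst fun φ hφ => ?_
    rw [inner_gradLp, hdivs φ φ.2.1 φ.2.2.1 φ.2.2.2]
    have : 0 ≤ ∫ x, (φ : EN N → ℝ) x ∂μs.toJordanDecomposition.negPart := integral_nonneg hφ
    change 0 ≤ -(_ - _) + ∫ x, (φ : EN N → ℝ) x ∂μs.toJordanDecomposition.posPart
    linarith
  have hle : α ≤ ν + β := by
    refine measure_le_of_forall_testSpace hA hμtA fun φ hφ hφ0 => ?_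
    have h1 := hmem ⟨φ, hφ⟩ hφ0
    rw [inner_gradLp, hdivt φ hφ.1 hφ.2.1 hφ.2.2] at h1
    change 0 ≤ -(∫ x, φ x ∂α - ∫ x, φ x ∂β) + ∫ x, φ x ∂ν at h1
    rw [integral_add_measure (integrable_of_mem_testSpace hφ ν)
      (integrable_of_mem_testSpace hφ β)]
    linarith
  obtain ⟨P, hP, hαP, hβP⟩ := μt.toJordanDecomposition.mutuallySingular
  refine Measure.le_iff.2 fun B _ => ?_
  calc α B = α (B ∩ Pᶜ) := (measure_inter_conull (by rwa [compl_compl])).symm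
    _ ≤ ν (B ∩ Pᶜ) + β (B ∩ Pᶜ) := hle _
    _ = ν (B ∩ Pᶜ) := by rw [measure_mono_null inter_subset_right hβP, add_zero]
    _ ≤ ν B := measure_mono inter_subset_left

end Flow

/-- along the gradient flow of `𝒟`, the positive and negative parts of
the divergence are nonincreasing: for `0 ≤ s < t`, `μ_t^± ≤ μ_s^±`. -/
theorem stmt_11 {N : ℕ} (hN : 1 ≤ N) (A : Set (EN N)) (hA : IsOpen A)
    (u0 : L2 A) (u : ℝ → L2 A) (hu : IsGradFlow A u0 u)
    (s t : ℝ) (hs : 0 ≤ s) (hst : s < t) (μs μt : SignedMeasure (EN N))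
    (hμsA : μs.totalVariation Aᶜ = 0) (hμtA : μt.totalVariation Aᶜ = 0)
    (hdivs : DivEq A ⇑(u s) μs) (hdivt : DivEq A ⇑(u t) μt) :
    μt.toJordanDecomposition.posPart ≤ μs.toJordanDecomposition.posPart ∧
    μt.toJordanDecomposition.negPart ≤ μs.toJordanDecomposition.negPart := by
  rw [SignedMeasure.totalVariation, Measure.add_apply, add_eq_zero] at hμtA
  refine ⟨hu.posPart_le hA hs hst hμtA.1 hdivs hdivt, ?_⟩
  have h := hu.neg.posPart_le hA hs hst (μs := -μs) (μt := -μt)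
    (by rw [SignedMeasure.toJordanDecomposition_neg]; exact hμtA.2) hdivs.neg hdivt.neg
  rwa [SignedMeasure.toJordanDecomposition_neg, SignedMeasure.toJordanDecomposition_neg] at h
end
end

section
/- Let N ≥ 1, let A ⊆ ℝ^N be open, let u0 ∈ L²(A;ℝ^N) with div u0 = μ0 for a finite signed Borel measure μ0 on A, and let u be a solution of the gradient flow of 𝒟 starting from u0 with div u(t) = μ_t (a finite signed Borel measure) for every t > 0. Then (μ_t)^± converges weakly-* to (μ0)^± as t → 0+: for every continuous function φ : A → ℝ with compact support, ∫_A φ d(μ_t)^+ → ∫_A φ d(μ0)^+ and ∫_A φ d(μ_t)^- → ∫_A φ d(μ0)^- as t → 0+. -/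
open MeasureTheory Topology Filter Metric Set
open scoped ENNReal RealInnerProductSpace

noncomputable section

open scoped Manifold in
/-- A smooth Urysohn function with compact support in a prescribed open set. -/
theorem exists_contDiff_one_on_compact {N : ℕ} {K U : Set (EN N)} (hK : IsCompact K)
    (hU : IsOpen U) (hKU : K ⊆ U) :
    ∃ f : EN N → ℝ, ContDiff ℝ (⊤ : ℕ∞) f ∧ HasCompactSupport f ∧ tsupport f ⊆ U ∧
      (∀ x ∈ K, f x = 1) ∧ ∀ x, f x ∈ Icc (0 : ℝ) 1 := by
  obtain ⟨L, hL, hKL, hLU⟩ := exists_compact_between hK hU hKU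
  obtain ⟨f, h1, h0, hf⟩ := exists_contMDiffMap_one_nhds_of_subset_interior
    𝓘(ℝ, EN N) (n := (⊤ : ℕ∞)) hK.isClosed hKL
  have hsupp : tsupport f ⊆ L :=
    closure_minimal (fun x hx => by_contra fun hxL => hx (h0 x hxL)) hL.isClosed
  exact ⟨f, f.contMDiff.contDiff, hL.of_isClosed_subset (isClosed_tsupport _) hsupp,
    hsupp.trans hLU, fun x hx => h1.self_of_nhdsSet x hx, hf⟩

/-- If `g ≤ 2` vanishes on `K` and `K` carries `P` up to mass `ε`, then `∫ g dP ≤ 2 ε`. -/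
theorem integral_le_of_eq_zero_on {X : Type*} [MeasurableSpace X]
    {P : Measure X} [IsFiniteMeasure P] {g : X → ℝ}
    {K : Set X} (hK : MeasurableSet K) (h0 : ∀ x ∈ K, g x = 0) (h2 : ∀ x, g x ≤ 2)
    (hg : Integrable g P) {ε : ℝ} (hε : P.real Kᶜ ≤ ε) : ∫ x, g x ∂P ≤ 2 * ε := by
  calc ∫ x, g x ∂P ≤ ∫ x, Kᶜ.indicator (fun _ => (2 : ℝ)) x ∂P := by
        refine integral_mono hg ((integrable_const _).indicator hK.compl) fun x => ?_
        by_cases hx : x ∈ K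
        · simp [hx, h0 x hx]
        · simpa [hx] using h2 x
    _ = 2 * P.real Kᶜ := by
        rw [integral_indicator hK.compl]; simp [mul_comm]
    _ ≤ 2 * ε := by gcongr

/-- A measurable set carrying a finite measure contains a compact set carrying it up to `ε`. -/
theorem exists_isCompact_real_compl_le {N : ℕ} (P : Measure (EN N)) [IsFiniteMeasure P]
    {S : Set (EN N)} (hS : MeasurableSet S) (hP : P Sᶜ = 0) {ε : ℝ} (hε : 0 < ε) :
    ∃ K ⊆ S, IsCompact K ∧ P.real Kᶜ ≤ ε := by
  obtain ⟨K, hKS, hK, hlt⟩ := hS.exists_isCompact_sdiff_lt (measure_ne_top P S)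
    (ENNReal.ofReal_pos.2 hε).ne'
  refine ⟨K, hKS, hK, ENNReal.toReal_le_of_le_ofReal hε.le ?_⟩
  have hsub : Kᶜ ⊆ Sᶜ ∪ S \ K := fun x hx => by
    by_cases h : x ∈ S
    · exact Or.inr ⟨h, hx⟩
    · exact Or.inl h
  calc P Kᶜ ≤ P Sᶜ + P (S \ K) := (measure_mono hsub).trans (measure_union_le _ _)
    _ ≤ ENNReal.ofReal ε := by rw [hP, zero_add]; exact hlt.le

theorem Continuous.integrable_of_abs_le {N : ℕ} (P : Measure (EN N)) [IsFiniteMeasure P]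
    {v : EN N → ℝ} (hv : Continuous v) {C : ℝ} (hC : ∀ x, |v x| ≤ C) : Integrable v P :=
  Integrable.of_bound hv.aestronglyMeasurable C (Eventually.of_forall hC)

/-- Mutually singular finite measures on an open set `A` are separated, up to `ε`, by a smooth
test function which is almost `1` for the first one and almost `-1` for the second one. -/
theorem exists_testFn_almost_norming {N : ℕ} {A : Set (EN N)} (hA : IsOpen A)
    (P Q : Measure (EN N)) [IsFiniteMeasure P] [IsFiniteMeasure Q] (hPQ : P ⟂ₘ Q)
    (hP : P Aᶜ = 0) (hQ : Q Aᶜ = 0) {ε : ℝ} (hε : 0 < ε) :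
    ∃ v : EN N → ℝ, TestFn A v ∧ ∫ x, (1 - v x) ∂P + ∫ x, (1 + v x) ∂Q ≤ ε := by
  obtain ⟨S, hS, hPS, hQS⟩ := hPQ
  obtain ⟨K, hKS, hK, hPK⟩ := exists_isCompact_real_compl_le P (hS.compl.inter hA.measurableSet)
    (by rw [compl_inter, compl_compl]; exact measure_union_null hPS hP)
    (show 0 < ε / 4 by positivity)
  obtain ⟨L, hLS, hL, hQL⟩ := exists_isCompact_real_compl_le Q (hS.inter hA.measurableSet)
    (by rw [compl_inter]; exact measure_union_null hQS hQ)
    (show 0 < ε / 4 by positivity)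
  obtain ⟨f, hf, hfc, hfs, hf1, hf01⟩ := exists_contDiff_one_on_compact hK
    (hA.inter hL.isClosed.isOpen_compl)
    (fun x hx => ⟨(hKS hx).2, fun hxL => (hKS hx).1 (hLS hxL).1⟩)
  obtain ⟨g, hg, hgc, hgs, hg1, hg01⟩ := exists_contDiff_one_on_compact hL
    (hA.inter hK.isClosed.isOpen_compl)
    (fun x hx => ⟨(hLS hx).2, fun hxK => (hKS hxK).1 (hLS hx).1⟩)
  have hf0 : ∀ x ∈ L, f x = 0 := fun x hx =>
    image_eq_zero_of_notMem_tsupport fun h => (hfs h).2 hx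
  have hg0 : ∀ x ∈ K, g x = 0 := fun x hx =>
    image_eq_zero_of_notMem_tsupport fun h => (hgs h).2 hx
  have hle : ∀ x, |f x - g x| ≤ 1 := fun x => by
    have h1 := hf01 x
    have h2 := hg01 x
    rw [abs_le]; constructor <;> linarith [h1.1, h1.2, h2.1, h2.2]
  have hint : ∀ R : Measure (EN N), IsFiniteMeasure R → Integrable (fun x => f x - g x) R :=
    fun R _ => (hf.continuous.sub hg.continuous).integrable_of_abs_le R hle
  refine ⟨fun x => f x - g x, ⟨hf.sub hg, hfc.sub hgc, ?_, hle⟩, ?_⟩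
  · refine (tsupport_sub f g).trans (union_subset (fun x hx => (hfs hx).1) fun x hx => (hgs hx).1)
  · have h1 := integral_le_of_eq_zero_on (P := P) (g := fun x => 1 - (f x - g x))
      hK.measurableSet (fun x hx => by simp [hf1 x hx, hg0 x hx])
      (fun x => by linarith [(abs_le.1 (hle x)).1])
      ((integrable_const _).sub (hint P inferInstance)) hPK
    have h2 := integral_le_of_eq_zero_on (P := Q) (g := fun x => 1 + (f x - g x))
      hL.measurableSet (fun x hx => by simp [hg1 x hx, hf0 x hx])
      (fun x => by linarith [(abs_le.1 (hle x)).2])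
      ((integrable_const _).add (hint Q inferInstance)) hQL
    linarith

/-- Testing against the gradient of a smooth compactly supported function is an `L²` pairing. -/
theorem exists_inner_eq_integral_gradient {N : ℕ} (A : Set (EN N)) {v : EN N → ℝ}
    (hv : ContDiff ℝ (⊤ : ℕ∞) v) (hvc : HasCompactSupport v) :
    ∃ G : L2 A, ∀ w : L2 A, ∫ x in A, ⟪w x, gradient v x⟫ = ⟪w, G⟫ := by
  have hcont : Continuous (gradient v) :=
    (InnerProductSpace.toDual ℝ (EN N)).symm.continuous.comp (hv.continuous_fderiv (by simp))
  have hcomp : HasCompactSupport (gradient v) :=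
    (hvc.fderiv (𝕜 := ℝ)).comp_left (g := (InnerProductSpace.toDual ℝ (EN N)).symm) (map_zero _)
  have hmem : MemLp (gradient v) 2 (volume.restrict A) :=
    hcont.memLp_of_hasCompactSupport hcomp
  refine ⟨hmem.toLp _, fun w => ?_⟩
  rw [L2.inner_def]
  refine integral_congr_ae ?_
  filter_upwards [hmem.coeFn_toLp] with x hx
  rw [hx]

/-- The energy of a subgradient flow never exceeds its initial value. Only the subgradient
inequality along the trajectory is used. -/
theorem energy_le_initial_of_subgradient_flow {H : Type*} [NormedAddCommGroup H]
    [InnerProductSpace ℝ H] (E : H → ℝ) (u : ℝ → H) (hu : ContinuousOn u (Ici 0))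
    (hE : ∀ t, IsClosed {r | r ∈ Icc 0 t ∧ E (u r) ≤ E (u 0)})
    (hflow : ∀ t, 0 < t → ∃ p : H,
      Tendsto (fun h : ℝ => h⁻¹ • (u (t + h) - u t)) (𝓝[>] (0:ℝ)) (𝓝 p) ∧
      ∀ s, 0 ≤ s → E (u t) + ⟪-p, u s - u t⟫ ≤ E (u s))
    {t : ℝ} (ht : 0 ≤ t) : E (u t) ≤ E (u 0) := by
  by_contra! hlt
  obtain ⟨s, ⟨⟨hs0, hst⟩, hsE⟩, hmax⟩ : ∃ s, IsGreatest {r | r ∈ Icc 0 t ∧ E (u r) ≤ E (u 0)} s :=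
    (isCompact_Icc.of_isClosed_subset (hE t) fun r hr => hr.1).exists_isGreatest
      ⟨0, ⟨le_rfl, ht⟩, le_rfl⟩
  have hst' : s < t := lt_of_le_of_ne hst (by rintro rfl; exact absurd hsE hlt.not_ge)
  have hgt : ∀ r, s < r → r ≤ t → E (u 0) < E (u r) := fun r hsr hrt =>
    not_le.1 fun h => (hmax ⟨⟨hs0.trans hsr.le, hrt⟩, h⟩).not_gt hsr
  have hf : ContinuousOn (fun r => ‖u r - u s‖ ^ 2) (Ici 0) :=
    ((hu.sub continuousOn_const).norm).pow 2
  have hanti : ∀ a, s < a → a < t → ‖u t - u s‖ ^ 2 ≤ ‖u a - u s‖ ^ 2 := fun a hsa hat => by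
    have ha0 : 0 < a := hs0.trans_lt hsa
    choose! p hp hpE using hflow
    refine image_le_of_deriv_right_le_deriv_boundary (f := fun r => ‖u r - u s‖ ^ 2)
      (f' := fun r => 2 * ⟪u r - u s, p r⟫) (B := fun _ => ‖u a - u s‖ ^ 2) (B' := fun _ => 0)
      (a := a) (b := t) (hf.mono fun r hr => ha0.le.trans hr.1) (fun r hr => ?_) le_rfl
      continuousOn_const (fun r _ => hasDerivWithinAt_const _ _ _) (fun r hr => ?_) ⟨hat.le, le_rfl⟩
    · have hr0 : 0 < r := ha0.trans_le hr.1
      have hder : HasDerivWithinAt u (p r) (Ici r) r := by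
        rw [← hasDerivWithinAt_Ioi_iff_Ici, hasDerivWithinAt_iff_tendsto_slope' self_notMem_Ioi]
        have hsub : Tendsto (fun z => z - r) (𝓝[>] r) (𝓝[>] 0) := by
          refine tendsto_nhdsWithin_iff.2 ⟨?_, ?_⟩
          · have : Tendsto (fun z => z - r) (𝓝 r) (𝓝 (r - r)) := tendsto_id.sub_const r
            rw [sub_self] at this
            exact this.mono_left nhdsWithin_le_nhds
          · filter_upwards [self_mem_nhdsWithin] with z hz using mem_Ioi.2 (sub_pos.2 (mem_Ioi.1 hz))
        refine ((hp r hr0).comp hsub).congr fun z => ?_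
        simp [slope_def_module]
      exact (hder.sub_const (u s)).norm_sq
    · have hr0 : 0 < r := ha0.trans_le hr.1
      have h1 := hpE r hr0 s hs0
      have h2 := hgt r (hsa.trans_le hr.1) hr.2.le
      have h3 : ⟪-p r, u s - u r⟫ = ⟪u r - u s, p r⟫ := by
        rw [← neg_sub (u r) (u s), inner_neg_neg, real_inner_comm]
      linarith
  have hlim : Tendsto (fun r => ‖u r - u s‖ ^ 2) (𝓝[>] s) (𝓝 0) := by
    have : Tendsto (fun r => ‖u r - u s‖ ^ 2) (𝓝[>] s) (𝓝 (‖u s - u s‖ ^ 2)) :=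
      (hf s hs0).mono_left (nhdsWithin_mono s fun r hr => hs0.trans (mem_Ioi.1 hr).le)
    simpa using this
  have hle : ‖u t - u s‖ ^ 2 ≤ 0 := ge_of_tendsto hlim (by
    filter_upwards [Ioo_mem_nhdsGT hst'] with a ha using hanti a ha.1 ha.2)
  have heq : u t = u s := sub_eq_zero.1 (norm_eq_zero.1 (pow_eq_zero_iff two_ne_zero |>.1
    (le_antisymm hle (sq_nonneg _))))
  rw [heq] at hlt
  exact absurd hsE hlt.not_ge

/-- If `v` almost separates `P` from `Q`, then `P` is almost the signed measure `P - Q` weighted by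
`(1 + v) / 2`. -/
theorem abs_integral_sub_weighted_le {N : ℕ} (P Q : Measure (EN N)) [IsFiniteMeasure P]
    [IsFiniteMeasure Q] {φ v : EN N → ℝ} (hφ : Continuous φ) (hv : Continuous v) {C ε : ℝ}
    (hC : ∀ x, |φ x| ≤ C) (hv1 : ∀ x, |v x| ≤ 1)
    (hε : ∫ x, (1 - v x) ∂P + ∫ x, (1 + v x) ∂Q ≤ ε) :
    |∫ x, φ x ∂P - (∫ x, φ x * (1 + v x) / 2 ∂P - ∫ x, φ x * (1 + v x) / 2 ∂Q)| ≤ C * ε := by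
  have hC0 : 0 ≤ C := (abs_nonneg _).trans (hC 0)
  have hm : ∀ x, 0 ≤ 1 - v x := fun x => by linarith [(abs_le.1 (hv1 x)).2]
  have hp : ∀ x, 0 ≤ 1 + v x := fun x => by linarith [(abs_le.1 (hv1 x)).1]
  have hvP := hv.integrable_of_abs_le P hv1
  have hvQ := hv.integrable_of_abs_le Q hv1
  have hφP := hφ.integrable_of_abs_le P hC
  have hφvP : Integrable (fun x => φ x * (1 + v x) / 2) P := by
    refine (by fun_prop : Continuous fun x => φ x * (1 + v x) / 2).integrable_of_abs_le P
      (C := C) fun x => ?_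
    rw [abs_div, abs_mul, abs_of_nonneg (hp x), abs_two]
    nlinarith [hC x, hm x, hp x, abs_nonneg (φ x)]
  have h1 : |∫ x, φ x * (1 - v x) / 2 ∂P| ≤ C * ∫ x, (1 - v x) ∂P := by
    rw [← integral_const_mul, ← Real.norm_eq_abs]
    refine norm_integral_le_of_norm_le (((integrable_const _).sub hvP).const_mul C)
      (Eventually.of_forall fun x => ?_)
    rw [Real.norm_eq_abs, abs_div, abs_mul, abs_of_nonneg (hm x), abs_two]
    nlinarith [hC x, hm x, mul_le_mul_of_nonneg_right (hC x) (hm x), mul_nonneg hC0 (hm x)]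
  have h2 : |∫ x, φ x * (1 + v x) / 2 ∂Q| ≤ C * ∫ x, (1 + v x) ∂Q := by
    rw [← integral_const_mul, ← Real.norm_eq_abs]
    refine norm_integral_le_of_norm_le (((integrable_const _).add hvQ).const_mul C)
      (Eventually.of_forall fun x => ?_)
    rw [Real.norm_eq_abs, abs_div, abs_mul, abs_of_nonneg (hp x), abs_two]
    nlinarith [hC x, hp x, mul_le_mul_of_nonneg_right (hC x) (hp x), mul_nonneg hC0 (hp x)]
  have h3 : ∫ x, φ x ∂P - ∫ x, φ x * (1 + v x) / 2 ∂P = ∫ x, φ x * (1 - v x) / 2 ∂P := by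
    rw [← integral_sub hφP hφvP]
    congr with x
    ring
  calc _ = |∫ x, φ x * (1 - v x) / 2 ∂P + ∫ x, φ x * (1 + v x) / 2 ∂Q| := by
        rw [← h3]; congr 1; ring
    _ ≤ C * ∫ x, (1 - v x) ∂P + C * ∫ x, (1 + v x) ∂Q :=
        (abs_add_le _ _).trans (add_le_add h1 h2)
    _ ≤ C * ε := by rw [← mul_add]; gcongr

/-- Signed measures of uniformly bounded mass which converge against smooth compactly supported
functions in `A` converge against continuous ones. -/
theorem tendsto_integral_sub_of_smooth {N : ℕ} {A : Set (EN N)} {ι : Type*} {l : Filter ι}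
    (P Q : ι → Measure (EN N)) [∀ i, IsFiniteMeasure (P i)] [∀ i, IsFiniteMeasure (Q i)]
    (P₀ Q₀ : Measure (EN N)) [IsFiniteMeasure P₀] [IsFiniteMeasure Q₀] {M : ℝ}
    (hM : ∀ᶠ i in l, (P i).real univ + (Q i).real univ ≤ M)
    (hM₀ : P₀.real univ + Q₀.real univ ≤ M)
    (hsmooth : ∀ ψ : EN N → ℝ, ContDiff ℝ (⊤ : ℕ∞) ψ → HasCompactSupport ψ → tsupport ψ ⊆ A →
      Tendsto (fun i => ∫ x, ψ x ∂P i - ∫ x, ψ x ∂Q i) l (𝓝 (∫ x, ψ x ∂P₀ - ∫ x, ψ x ∂Q₀)))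
    {φ : EN N → ℝ} (hφ : Continuous φ) (hφc : HasCompactSupport φ) (hφA : tsupport φ ⊆ A) :
    Tendsto (fun i => ∫ x, φ x ∂P i - ∫ x, φ x ∂Q i) l
      (𝓝 (∫ x, φ x ∂P₀ - ∫ x, φ x ∂Q₀)) := by
  have hM0 : 0 ≤ M := (add_nonneg measureReal_nonneg measureReal_nonneg).trans hM₀
  rw [Metric.tendsto_nhds]
  intro ε hε
  set δ := ε / (3 * (M + 1)) with hδ
  have hδ0 : 0 < δ := by positivity
  have hδM : δ * M < ε / 3 := by
    have : δ * (M + 1) = ε / 3 := by rw [hδ]; field_simp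
    linarith
  obtain ⟨ψ, hψ, hdist, hsupp⟩ := hφ.exists_contDiff_approx (⊤ : ℕ∞)
    (continuous_const (y := δ)) fun _ => hδ0
  have hψs : tsupport ψ ⊆ tsupport φ := closure_mono hsupp
  have hψc : HasCompactSupport ψ := hφc.of_isClosed_subset (isClosed_tsupport _) hψs
  have hclose : ∀ ν : Measure (EN N), IsFiniteMeasure ν →
      |∫ x, ψ x ∂ν - ∫ x, φ x ∂ν| ≤ δ * ν.real univ := fun ν _ => by
    rw [← integral_sub (hψ.continuous.integrable_of_hasCompactSupport hψc)
      (hφ.integrable_of_hasCompactSupport hφc), ← Real.norm_eq_abs]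
    exact norm_integral_le_of_norm_le_const (Eventually.of_forall fun x => (hdist x).le)
  have hpair : ∀ ν ρ : Measure (EN N), IsFiniteMeasure ν → IsFiniteMeasure ρ →
      ν.real univ + ρ.real univ ≤ M →
      |(∫ x, ψ x ∂ν - ∫ x, ψ x ∂ρ) - (∫ x, φ x ∂ν - ∫ x, φ x ∂ρ)| < ε / 3 :=
    fun ν ρ hR hS h => by
      have h1 := abs_le.1 (hclose ν hR)
      have h2 := abs_le.1 (hclose ρ hS)
      have h3 := mul_le_mul_of_nonneg_left h hδ0.le
      rw [abs_lt]
      constructor <;> linarith [h1.1, h1.2, h2.1, h2.2]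
  filter_upwards [hM, Metric.tendsto_nhds.1 (hsmooth ψ hψ hψc (hψs.trans hφA)) (ε / 3)
    (by positivity)] with i hi hψi
  have h1 := abs_lt.1 (hpair (P i) (Q i) inferInstance inferInstance hi)
  have h2 := abs_lt.1 (hpair P₀ Q₀ inferInstance inferInstance hM₀)
  rw [Real.dist_eq, abs_lt] at hψi ⊢
  constructor <;> linarith [h1.1, h1.2, h2.1, h2.2, hψi.1, hψi.2]

/-- If mutually singular pairs `(P i, Q i)` have no more mass than `(P₀, Q₀)` and `P i - Q i`
converges to `P₀ - Q₀` in the sense of distributions, then `P i` converges to `P₀`. -/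
theorem tendsto_integral_posPart_of_mass_le {N : ℕ} {A : Set (EN N)} (hA : IsOpen A)
    {ι : Type*} {l : Filter ι}
    (P Q : ι → Measure (EN N)) [∀ i, IsFiniteMeasure (P i)] [∀ i, IsFiniteMeasure (Q i)]
    (P₀ Q₀ : Measure (EN N)) [IsFiniteMeasure P₀] [IsFiniteMeasure Q₀]
    (hPQ : P₀ ⟂ₘ Q₀) (hP : P₀ Aᶜ = 0) (hQ : Q₀ Aᶜ = 0)
    (hM : ∀ᶠ i in l, (P i).real univ + (Q i).real univ ≤ P₀.real univ + Q₀.real univ)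
    (hsmooth : ∀ ψ : EN N → ℝ, ContDiff ℝ (⊤ : ℕ∞) ψ → HasCompactSupport ψ → tsupport ψ ⊆ A →
      Tendsto (fun i => ∫ x, ψ x ∂P i - ∫ x, ψ x ∂Q i) l (𝓝 (∫ x, ψ x ∂P₀ - ∫ x, ψ x ∂Q₀)))
    {φ : EN N → ℝ} (hφ : Continuous φ) (hφc : HasCompactSupport φ) (hφA : tsupport φ ⊆ A) :
    Tendsto (fun i => ∫ x, φ x ∂P i) l (𝓝 (∫ x, φ x ∂P₀)) := by
  obtain ⟨C, hC⟩ : ∃ C, ∀ x, |φ x| ≤ C := hφc.exists_bound_of_continuous hφ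
  have hC0 : 0 ≤ C := (abs_nonneg _).trans (hC 0)
  rw [Metric.tendsto_nhds]
  intro ε hε
  set δ := ε / (6 * (C + 1)) with hδ
  have hδ0 : 0 < δ := by positivity
  have hδC : C * δ < ε / 6 := by
    have : (C + 1) * δ = ε / 6 := by rw [hδ]; field_simp
    linarith
  obtain ⟨v, ⟨hv, hvc, hvA, hv1⟩, hvε⟩ := exists_testFn_almost_norming hA P₀ Q₀ hPQ hP hQ hδ0
  have hsplit : ∀ ν ρ : Measure (EN N), IsFiniteMeasure ν → IsFiniteMeasure ρ →
      ∫ x, (1 - v x) ∂ν + ∫ x, (1 + v x) ∂ρ =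
        ν.real univ + ρ.real univ - (∫ x, v x ∂ν - ∫ x, v x ∂ρ) := fun ν ρ _ _ => by
    rw [integral_sub (integrable_const _) (hv.continuous.integrable_of_abs_le ν hv1),
      integral_add (integrable_const _) (hv.continuous.integrable_of_abs_le ρ hv1)]
    simp only [integral_const, smul_eq_mul, mul_one]
    ring
  have hw : Continuous fun x => φ x * (1 + v x) / 2 := by
    have := hv.continuous
    fun_prop
  have hws : Function.support (fun x => φ x * (1 + v x) / 2) ⊆ Function.support φ :=
    fun x hx h => hx (by simp [h])
  have hlim := tendsto_integral_sub_of_smooth P Q P₀ Q₀ hM le_rfl hsmooth hw (hφc.mono hws)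
    ((closure_mono hws).trans hφA)
  filter_upwards [hM, Metric.tendsto_nhds.1 (hsmooth v hv hvc hvA) δ hδ0,
    Metric.tendsto_nhds.1 hlim (ε / 3) (by positivity)] with i hi hvi hwi
  rw [Real.dist_eq, abs_lt] at hvi hwi
  have h1 := abs_le.1 (abs_integral_sub_weighted_le P₀ Q₀ hφ hv.continuous hC hv1 hvε)
  have hvε' : ∫ x, (1 - v x) ∂P i + ∫ x, (1 + v x) ∂Q i ≤ 2 * δ := by
    rw [hsplit _ _ inferInstance inferInstance] at hvε ⊢
    linarith [hvi.1]
  have h2 := abs_le.1 (abs_integral_sub_weighted_le (P i) (Q i) hφ hv.continuous hC hv1 hvε')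
  rw [Real.dist_eq, abs_lt]
  constructor <;> linarith [h1.1, h1.2, h2.1, h2.2, hwi.1, hwi.2]

/-- If `div u = μ` then `𝒟(u)` is at most the mass of `μ`. -/
theorem DivEq.divTV_le {N : ℕ} {A : Set (EN N)} {u : EN N → EN N} {μ : SignedMeasure (EN N)}
    (h : DivEq A u μ) :
    divTV A u ≤ ENNReal.ofReal (μ.toJordanDecomposition.posPart.real univ +
      μ.toJordanDecomposition.negPart.real univ) := by
  refine iSup_le fun ⟨v, hv, hvc, hvA, hv1⟩ => ENNReal.ofReal_le_ofReal ?_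
  rw [h v hv hvc hvA, neg_neg]
  have hb : ∀ ν : Measure (EN N), IsFiniteMeasure ν → |∫ x, v x ∂ν| ≤ ν.real univ := fun ν _ => by
    rw [← one_mul (ν.real univ), ← Real.norm_eq_abs]
    exact norm_integral_le_of_norm_le_const (Eventually.of_forall hv1)
  have h1 := abs_le.1 (hb μ.toJordanDecomposition.posPart inferInstance)
  have h2 := abs_le.1 (hb μ.toJordanDecomposition.negPart inferInstance)
  linarith [h1.2, h2.1]

theorem neg_integral_gradient_le_divTV {N : ℕ} {A : Set (EN N)} {u : EN N → EN N}
    (hu : divTV A u ≠ ⊤) {v : EN N → ℝ} (hv : TestFn A v) :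
    -∫ x in A, ⟪u x, gradient v x⟫ ≤ (divTV A u).toReal := by
  rw [← ENNReal.ofReal_le_iff_le_toReal hu]
  exact le_iSup (fun v : {v : EN N → ℝ // TestFn A v} =>
    ENNReal.ofReal (-∫ x in A, ⟪u x, gradient (v : EN N → ℝ) x⟫)) ⟨v, hv⟩

/-- If `div u = μ` with `μ` carried by the open set `A`, the mass of `μ` is at most `𝒟(u)`. -/
theorem DivEq.mass_le {N : ℕ} {A : Set (EN N)} (hA : IsOpen A) {u : EN N → EN N}
    {μ : SignedMeasure (EN N)} (h : DivEq A u μ) (hμ : μ.totalVariation Aᶜ = 0)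
    (hu : divTV A u ≠ ⊤) :
    μ.toJordanDecomposition.posPart.real univ + μ.toJordanDecomposition.negPart.real univ ≤
      (divTV A u).toReal := by
  rw [SignedMeasure.totalVariation, Measure.add_apply, add_eq_zero] at hμ
  refine le_of_forall_pos_le_add fun ε hε => ?_
  obtain ⟨v, hv, hvε⟩ := exists_testFn_almost_norming hA _ _
    μ.toJordanDecomposition.mutuallySingular hμ.1 hμ.2 hε
  have hle := neg_integral_gradient_le_divTV hu hv
  rw [h v hv.1 hv.2.1 hv.2.2.1, neg_neg] at hle
  rw [integral_sub (integrable_const _) (hv.1.continuous.integrable_of_abs_le _ hv.2.2.2),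
    integral_add (integrable_const _) (hv.1.continuous.integrable_of_abs_le _ hv.2.2.2)] at hvε
  simp only [integral_const, smul_eq_mul, mul_one] at hvε
  linarith

/-- `(μ_t)^± ⇀* (μ0)^±` as `t → 0+`: the positive and negative parts of
the divergence converge weakly-* (tested against continuous compactly supported
functions) to those of the initial divergence. -/
theorem stmt_12 {N : ℕ} (hN : 1 ≤ N) (A : Set (EN N)) (hA : IsOpen A)
    (u0 : L2 A) (u : ℝ → L2 A) (hu : IsGradFlow A u0 u)
    (μ0 : SignedMeasure (EN N)) (μ : ℝ → SignedMeasure (EN N))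
    (hμ0A : μ0.totalVariation Aᶜ = 0) (hμA : ∀ t : ℝ, 0 < t → (μ t).totalVariation Aᶜ = 0)
    (hdiv0 : DivEq A ⇑u0 μ0) (hdiv : ∀ t : ℝ, 0 < t → DivEq A ⇑(u t) (μ t)) :
    ∀ φ : EN N → ℝ, Continuous φ → HasCompactSupport φ → tsupport φ ⊆ A →
      Tendsto (fun t : ℝ => ∫ x, φ x ∂(μ t).toJordanDecomposition.posPart)
        (𝓝[>] (0:ℝ)) (𝓝 (∫ x, φ x ∂μ0.toJordanDecomposition.posPart)) ∧
      Tendsto (fun t : ℝ => ∫ x, φ x ∂(μ t).toJordanDecomposition.negPart)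
        (𝓝[>] (0:ℝ)) (𝓝 (∫ x, φ x ∂μ0.toJordanDecomposition.negPart)) := by
  intro φ hφ hφc hφA
  obtain ⟨hcont, rfl, hflow⟩ := hu
  have hfin : ∀ t, 0 ≤ t → divTV A (u t) ≠ ⊤ := fun t ht => by
    rcases ht.eq_or_lt with rfl | ht
    · exact ne_top_of_le_ne_top ENNReal.ofReal_ne_top hdiv0.divTV_le
    · obtain ⟨p, -, hp, -⟩ := hflow t ht
      exact hp
  have hpair : ∀ v : EN N → ℝ, ContDiff ℝ (⊤ : ℕ∞) v → HasCompactSupport v →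
      ContinuousOn (fun t => ∫ x in A, ⟪u t x, gradient v x⟫) (Ici 0) := fun v hv hvc => by
    obtain ⟨G, hG⟩ := exists_inner_eq_integral_gradient A hv hvc
    simp only [hG]
    exact hcont.inner continuousOn_const
  have henergy : ∀ t, 0 ≤ t → (divTV A (u t)).toReal ≤ (divTV A (u 0)).toReal := fun t ht => by
    refine energy_le_initial_of_subgradient_flow (fun w : L2 A => (divTV A w).toReal) u hcont
      (fun T => ?_) (fun s hs => ?_) ht
    · have hset : {r | r ∈ Icc 0 T ∧ (divTV A (u r)).toReal ≤ (divTV A (u 0)).toReal} =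
          ⋂ v : {v : EN N → ℝ // TestFn A v}, {r | r ∈ Icc 0 T ∧
            -∫ x in A, ⟪u r x, gradient (v : EN N → ℝ) x⟫ ≤ (divTV A (u 0)).toReal} := by
        ext r
        simp only [mem_iInter, mem_ofPred_eq]
        refine ⟨fun h v => ⟨h.1, (neg_integral_gradient_le_divTV (hfin r h.1.1) v.2).trans h.2⟩,
          fun h => ?_⟩
        have hr := (h ⟨0, contDiff_const, HasCompactSupport.zero, by simp [tsupport],
          by simp⟩).1
        refine ⟨hr, ENNReal.toReal_mono (hfin 0 le_rfl) (iSup_le fun v => ?_)⟩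
        exact ENNReal.ofReal_le_of_le_toReal (h v).2
      rw [hset]
      refine isClosed_iInter fun v => ?_
      exact ((hpair v v.2.1 v.2.2.1).neg.mono fun r hr => hr.1).preimage_isClosed_of_isClosed
        isClosed_Icc isClosed_Iic
    · obtain ⟨p, hp, -, hsub⟩ := hflow s hs
      exact ⟨p, hp, fun r hr => hsub (u r) (hfin r hr)⟩
  have hmass : ∀ᶠ t in 𝓝[>] (0:ℝ), (μ t).toJordanDecomposition.posPart.real univ +
      (μ t).toJordanDecomposition.negPart.real univ ≤
      μ0.toJordanDecomposition.posPart.real univ +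
      μ0.toJordanDecomposition.negPart.real univ := by
    filter_upwards [self_mem_nhdsWithin] with t ht
    replace ht : 0 < t := ht
    calc _ ≤ (divTV A (u t)).toReal := (hdiv t ht).mass_le hA (hμA t ht) (hfin t ht.le)
      _ ≤ (divTV A (u 0)).toReal := henergy t ht.le
      _ ≤ _ := ENNReal.toReal_le_of_le_ofReal (by positivity) hdiv0.divTV_le
  have hsmooth : ∀ ψ : EN N → ℝ, ContDiff ℝ (⊤ : ℕ∞) ψ → HasCompactSupport ψ → tsupport ψ ⊆ A →
      Tendsto (fun t => ∫ x, ψ x ∂(μ t).toJordanDecomposition.posPart -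
        ∫ x, ψ x ∂(μ t).toJordanDecomposition.negPart) (𝓝[>] (0:ℝ))
        (𝓝 (∫ x, ψ x ∂μ0.toJordanDecomposition.posPart -
          ∫ x, ψ x ∂μ0.toJordanDecomposition.negPart)) := fun ψ hψ hψc hψA => by
    have h := (((hpair ψ hψ hψc) 0 self_mem_Ici).mono_left
      (nhdsWithin_mono (0:ℝ) Ioi_subset_Ici_self)).neg
    beta_reduce at h
    rw [hdiv0 ψ hψ hψc hψA, neg_neg] at h
    refine h.congr' ?_
    filter_upwards [self_mem_nhdsWithin] with t ht
    rw [hdiv t ht ψ hψ hψc hψA, neg_neg]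
  rw [SignedMeasure.totalVariation, Measure.add_apply, add_eq_zero] at hμ0A
  have hpos := tendsto_integral_posPart_of_mass_le hA
    (fun t => (μ t).toJordanDecomposition.posPart) (fun t => (μ t).toJordanDecomposition.negPart)
    _ _ μ0.toJordanDecomposition.mutuallySingular hμ0A.1 hμ0A.2 hmass hsmooth hφ hφc hφA
  refine ⟨hpos, ?_⟩
  have hdiff := tendsto_integral_sub_of_smooth
    (fun t => (μ t).toJordanDecomposition.posPart) (fun t => (μ t).toJordanDecomposition.negPart)
    _ _ hmass le_rfl hsmooth hφ hφc hφA
  simpa using hpos.sub hdiff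
end
end
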